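/- arXiv:1808.03970 — 2 statements merged into one kernel-verified Lean document; each statement's English description precedes it below -/
import Mathlib

section
/- For every α ∈ (0,1) there exist m ∈ ℕ and a first-order sentence φ in the language L_m such that the sequence n ↦ P(G(n, n^{−α}) EMSO-satisfies φ) does not converge as n → ∞ (i.e., the existential monadic second order convergence law fails for G(n, n^{−α})). -/
open Filter FirstOrder

noncomputable section

/-! ### The binomial random graph `G(n,p)` -/

/-- The number of edges of a simple graph. -/
noncomputable def edgeCt {n : ℕ} (G : SimpleGraph (Fin n)) : ℕ := Nat.card G.edgeSet

open scoped Classical in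
/-- `prob n p Q` is the probability that the binomial random graph `G(n,p)` (on vertex set
`Fin n`) has property `Q`: the sum over all graphs `G` with `Q G` of
`p^{e(G)} (1-p)^{n(n-1)/2 - e(G)}`. -/
noncomputable def prob (n : ℕ) (p : ℝ) (Q : SimpleGraph (Fin n) → Prop) : ℝ :=
  ∑ G : SimpleGraph (Fin n),
    if Q G then p ^ edgeCt G * (1 - p) ^ (n * (n - 1) / 2 - edgeCt G) else 0

/-- `expec n p W` is the expectation of a real-valued function `W` of the binomial random
graph `G(n,p)`. -/
noncomputable def expec (n : ℕ) (p : ℝ) (W : SimpleGraph (Fin n) → ℝ) : ℝ :=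
  ∑ G : SimpleGraph (Fin n),
    W G * (p ^ edgeCt G * (1 - p) ^ (n * (n - 1) / 2 - edgeCt G))

/-! ### The graphs `W_a^γ` and `W_a^{γ,*}` -/

/-- `ωr r a = (r^a − 1)/(r−1)`, the number of vertices of the perfect `r`-ary tree of
depth `a − 1`. -/
def ωr (r a : ℕ) : ℕ := (r ^ a - 1) / (r - 1)

/-- The depth of the node with (0-based) breadth-first (heap) index `j` in the infinite
`r`-ary tree: the root has index 0, and the parent of node `j ≥ 1` is node `(j−1)/r`. -/
def heapDepth (r : ℕ) : ℕ → ℕ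
  | 0 => 0
  | j + 1 => heapDepth r (j / r) + 1
  decreasing_by exact Nat.lt_succ_of_le (Nat.div_le_self _ _)

/-- The vertex set of `W_a^γ`: the path `F₁` on `a` vertices (`Sum.inl`), together with,
for each of the `(4^a−1)/3` vertices `i` of the perfect 4-ary tree `F₂` (in breadth-first
order), the vertex `(i,0)` of `F₂` itself and the `γ` inner vertices `(i,1),…,(i,γ)` of the
path `P_{γ+2}` joining `i` to the vertex of `F₁` at the same distance from the root. -/
abbrev WVert (γ a : ℕ) := Fin a ⊕ (Fin (ωr 4 a) × Fin (γ + 1))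

/-- Base (directed) adjacency relation generating `W_a^γ`: consecutive `F₁`-vertices;
the last inner path vertex `(i,γ)` is joined to the `F₁`-vertex at depth of `i`;
consecutive vertices along each `P_{γ+2}`; and tree edges of the perfect 4-ary tree
(in heap indexing, `j` is the parent of `i ≥ 1` iff `j = (i−1)/4`). -/
def Wbase (γ a : ℕ) : WVert γ a → WVert γ a → Prop
  | Sum.inl u, Sum.inl v => (v : ℕ) = (u : ℕ) + 1
  | Sum.inl u, Sum.inr iv => (iv.2 : ℕ) = γ ∧ heapDepth 4 (iv.1 : ℕ) = (u : ℕ)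
  | Sum.inr _, Sum.inl _ => False
  | Sum.inr iv, Sum.inr jw =>
      (iv.1 = jw.1 ∧ (jw.2 : ℕ) = (iv.2 : ℕ) + 1) ∨
      ((iv.2 : ℕ) = 0 ∧ (jw.2 : ℕ) = 0 ∧ 1 ≤ (iv.1 : ℕ) ∧ (jw.1 : ℕ) = ((iv.1 : ℕ) - 1) / 4)

/-- The graph `W_a^γ`. -/
def WG (γ a : ℕ) : SimpleGraph (WVert γ a) := SimpleGraph.fromRel (Wbase γ a)

/-- The vertex set of `W_a^{γ,*}` (with `ω₁ = ωr r a`, `ω₂ = ωr r ω₁`), as five pieces: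
the path `F₁` on `a` vertices; the tree `F₂` together with the inner vertices of the
paths `P_{γ+2}` joining `F₂` to `F₁` (pairs `(i,k)`, `k = 0` being the `F₂`-vertex itself);
the `γ` inner vertices of the paths `P_{γ+2}` joining the `i`-th vertex of `F₂` (in
breadth-first order) to the `i`-th vertex of the path `F̃₁`; the path `F̃₁` on `ω₁`
vertices; and the tree `F̃₂` together with the inner vertices of the paths `P_{γ+2}`
joining `F̃₂` to `F̃₁`. -/
abbrev WSVert (γ r a : ℕ) :=
  Fin a ⊕ ((Fin (ωr r a) × Fin (γ + 1)) ⊕ ((Fin (ωr r a) × Fin γ) ⊕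
    (Fin (ωr r a) ⊕ (Fin (ωr r (ωr r a)) × Fin (γ + 1)))))

/-- Base (directed) adjacency relation generating `W_a^{γ,*}`. -/
def WSbase (γ r a : ℕ) : WSVert γ r a → WSVert γ r a → Prop
  | .inl u, .inl v => (v : ℕ) = (u : ℕ) + 1
  | .inl u, .inr (.inl iv) => (iv.2 : ℕ) = γ ∧ heapDepth r (iv.1 : ℕ) = (u : ℕ)
  | .inr (.inl iv), .inr (.inl jw) =>
      (iv.1 = jw.1 ∧ (jw.2 : ℕ) = (iv.2 : ℕ) + 1) ∨
      ((iv.2 : ℕ) = 0 ∧ (jw.2 : ℕ) = 0 ∧ 1 ≤ (iv.1 : ℕ) ∧ (jw.1 : ℕ) = ((iv.1 : ℕ) - 1) / r)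
  | .inr (.inl iv), .inr (.inr (.inl jm)) => (iv.2 : ℕ) = 0 ∧ iv.1 = jm.1 ∧ (jm.2 : ℕ) = 0
  | .inr (.inl iv), .inr (.inr (.inr (.inl d))) => γ = 0 ∧ (iv.2 : ℕ) = 0 ∧ (iv.1 : ℕ) = (d : ℕ)
  | .inr (.inr (.inl im)), .inr (.inr (.inl jm)) => im.1 = jm.1 ∧ (jm.2 : ℕ) = (im.2 : ℕ) + 1
  | .inr (.inr (.inl im)), .inr (.inr (.inr (.inl d))) =>
      (im.2 : ℕ) + 1 = γ ∧ (im.1 : ℕ) = (d : ℕ)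
  | .inr (.inr (.inr (.inl d))), .inr (.inr (.inr (.inl e))) => (e : ℕ) = (d : ℕ) + 1
  | .inr (.inr (.inr (.inl d))), .inr (.inr (.inr (.inr jw))) =>
      (jw.2 : ℕ) = γ ∧ heapDepth r (jw.1 : ℕ) = (d : ℕ)
  | .inr (.inr (.inr (.inr iv))), .inr (.inr (.inr (.inr jw))) =>
      (iv.1 = jw.1 ∧ (jw.2 : ℕ) = (iv.2 : ℕ) + 1) ∨
      ((iv.2 : ℕ) = 0 ∧ (jw.2 : ℕ) = 0 ∧ 1 ≤ (iv.1 : ℕ) ∧ (jw.1 : ℕ) = ((iv.1 : ℕ) - 1) / r)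
  | _, _ => False

/-- The graph `W_a^{γ,*}`. -/
def WSG (γ r a : ℕ) : SimpleGraph (WSVert γ r a) := SimpleGraph.fromRel (WSbase γ r a)

/-- `Vnum γ r a = V_{γ,r}(a) = a + 2(γ+1)ω_r(a) + (γ+1)ω_r(ω_r(a))`,
the number of vertices of `W_a^{γ,*}`. -/
def Vnum (γ r a : ℕ) : ℕ := a + 2 * (γ + 1) * ωr r a + (γ + 1) * ωr r (ωr r a)

/-- `s` is (the vertex set of) an induced copy of `H` in `G`. -/
def IsInducedCopy {V W : Type} (H : SimpleGraph W) (G : SimpleGraph V) (s : Set V) : Prop :=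
  Nonempty (H ≃g G.induce s)

/-! ### The quantities `k_γ` and `f` -/

/-- `kcoef α γ = k_γ = 2(1 − α(γ+2)/(γ+1))`. -/
def kcoef (α : ℝ) (γ : ℕ) : ℝ := 2 * (1 - α * ((γ : ℝ) + 2) / ((γ : ℝ) + 1))

/-- `ff α x = f(x) = x^α · ln x`. -/
def ff (α x : ℝ) : ℝ := x ^ α * Real.log x

/-! ### The language `L_m` and EMSO satisfaction -/

/-- Relation symbols of the language `L_m`: `m` unary symbols and one binary symbol. -/
def LRel (m : ℕ) : ℕ → Type
  | 1 => Fin m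
  | 2 => Unit
  | _ => Empty

/-- The first-order language `L_m`: one binary relation symbol, `m` unary relation symbols
and no function symbols. -/
def Lang (m : ℕ) : Language where
  Functions := fun _ => Empty
  Relations := LRel m

/-- The `L_m`-structure on `Fin n` whose binary relation is adjacency in the graph `G` and
whose `i`-th unary relation is membership in `S i`. -/
def structOf {n m : ℕ} (G : SimpleGraph (Fin n)) (S : Fin m → Set (Fin n)) :
    (Lang m).Structure (Fin n) where
  funMap := fun f _ => Empty.elim f
  RelMap := fun {k} r v =>
    match k, r, v with
    | 1, i, v => v 0 ∈ S i
    | 2, _, v => G.Adj (v 0) (v 1)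
    | 0, r, _ => Empty.elim r
    | (_ + 3), r, _ => Empty.elim r

/-- `G` EMSO-satisfies the `L_m`-sentence `φ`: there are sets `S 0, …, S (m-1)` of vertices
such that the structure on `Fin n` given by adjacency in `G` and membership in the `S i`
satisfies `φ`. -/
def EMSOSat {n m : ℕ} (G : SimpleGraph (Fin n)) (φ : (Lang m).Sentence) : Prop :=
  ∃ S : Fin m → Set (Fin n),
    @FirstOrder.Language.Sentence.Realize (Lang m) (Fin n) (structOf G S) φ

section RandomGraph

open MeasureTheory ProbabilityTheory unitInterval SimpleGraph

/-- The event `A` depends only on which pairs in `F` are edges. -/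
def DependsOnEdges {V : Type*} (A : Set (SimpleGraph V)) (F : Set (Sym2 V)) : Prop :=
  ∀ ⦃G₁ G₂ : SimpleGraph V⦄, (∀ e ∈ F, e ∈ G₁.edgeSet ↔ e ∈ G₂.edgeSet) → G₁ ∈ A → G₂ ∈ A

/-- The product measure on edge indicators that induces the binomial random graph. -/
def edgeMeasure (V : Type*) (p : I) : Measure (Sym2 V → Prop) :=
  Measure.infinitePi (fun e : Sym2 V ↦
    toNNReal p • Measure.dirac (e ∈ (Sym2.diagSetᶜ : Set (Sym2 V))) +
      toNNReal (σ p) • Measure.dirac False)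

theorem binomialRandom_eq_edgeMeasure_map (V : Type*) [Countable V] (p : I) :
    binomialRandom V p =
      (edgeMeasure V p).map (fun f => fromEdgeSet {e | f e}) := by
  rw [binomialRandom_eq_map, setBernoulli_eq_map, Measure.map_map (by fun_prop) (by fun_prop)]
  rfl

instance (V : Type*) [Countable V] : MeasurableSingletonClass (SimpleGraph V) where
  measurableSet_singleton G := by
    have h : ({G} : Set (SimpleGraph V)) = edgeSet ⁻¹' {G.edgeSet} := by
      ext; simp
    rw [h]
    exact measurableEmbedding_edgeSet.measurable (measurableSet_singleton _)

theorem measurableSet_simpleGraph {V : Type*} [Finite V] (A : Set (SimpleGraph V)) :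
    MeasurableSet A := A.toFinite.measurableSet

theorem binomialRandom_real_eq {V : Type*} [Finite V] (p : I) (A : Set (SimpleGraph V)) :
    (binomialRandom V p).real A =
      (edgeMeasure V p).real ((fun f => fromEdgeSet {e | f e}) ⁻¹' A) := by
  rw [binomialRandom_eq_edgeMeasure_map, map_measureReal_apply _ (measurableSet_simpleGraph A)]
  fun_prop

theorem DependsOnEdges.real_inter {V : Type*} [Finite V] (p : I) {A B : Set (SimpleGraph V)}
    {F F' : Set (Sym2 V)} (hA : DependsOnEdges A F) (hB : DependsOnEdges B F')
    (hF : Disjoint F F') :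
    (binomialRandom V p).real (A ∩ B) =
      (binomialRandom V p).real A * (binomialRandom V p).real B := by
  classical
  have := Fintype.ofFinite V
  have hpre : ∀ {A : Set (SimpleGraph V)} {F : Set (Sym2 V)}, DependsOnEdges A F →
      (fun f : Sym2 V → Prop => fromEdgeSet {e | f e}) ⁻¹' A =
        (fun f (i : F.toFinset) => f i) ⁻¹' ((fun f (i : F.toFinset) => f i) ''
          ((fun f : Sym2 V → Prop => fromEdgeSet {e | f e}) ⁻¹' A)) := by
    intro A F hA
    refine (Set.subset_preimage_image _ _).antisymm ?_
    rintro f ⟨g, hg, hgf⟩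
    refine hA (fun e he => ?_) hg
    have : g e ↔ f e := iff_of_eq (congrFun hgf ⟨e, by simpa using he⟩)
    simp [edgeSet_fromEdgeSet, this]
  have hind : iIndepFun (fun (e : Sym2 V) (f : Sym2 V → Prop) => f e) (edgeMeasure V p) :=
    iIndepFun_infinitePi (X := fun _ q => q) (fun _ => measurable_id)
  have h2 := hind.indepFun_finset F.toFinset F'.toFinset (by simpa using hF)
    (fun i => measurable_pi_apply i)
  rw [binomialRandom_real_eq, binomialRandom_real_eq, binomialRandom_real_eq, Set.preimage_inter,
    hpre hA, hpre hB, measureReal_def, h2.measure_inter_preimage_eq_mul _ _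
      (DiscreteMeasurableSpace.forall_measurableSet _)
      (DiscreteMeasurableSpace.forall_measurableSet _), ENNReal.toReal_mul]
  rfl

theorem binomialRandom_real_adj {V : Type*} [Finite V] (p : I) {u v : V} (h : u ≠ v) :
    (binomialRandom V p).real {G | G.Adj u v} = p := by
  have h1 : (fun f : Sym2 V → Prop => fromEdgeSet {e | f e}) ⁻¹' {G : SimpleGraph V | G.Adj u v} =
      (fun f => f s(u, v)) ⁻¹' {True} := by
    ext f; simp [h]
  rw [binomialRandom_real_eq, h1, ← map_measureReal_apply (measurable_pi_apply _)
    (DiscreteMeasurableSpace.forall_measurableSet _), edgeMeasure]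
  rw [Measure.infinitePi_map_eval]
  simp [measureReal_def, h]

theorem binomialRandom_real_singleton {V : Type*} [Fintype V] (p : I) (G : SimpleGraph V) :
    (binomialRandom V p).real {G} = p ^ G.edgeSet.ncard *
      (1 - p : ℝ) ^ ((Nat.card V).choose 2 - G.edgeSet.ncard) := by
  simp [measureReal_def, binomialRandom_singleton]

theorem prob_eq_binomialRandom_real (n : ℕ) (p : I) (Q : SimpleGraph (Fin n) → Prop) :
    prob n p Q = (binomialRandom (Fin n) p).real {G | Q G} := by
  classical
  have h : {G : SimpleGraph (Fin n) | Q G} = ((Finset.univ.filter Q : Finset _) : Set _) := by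
    ext; simp
  rw [h, ← sum_measureReal_singleton, prob, Finset.sum_filter]
  refine Finset.sum_congr rfl fun G _ => ?_
  split_ifs with hQ
  · rw [binomialRandom_real_singleton, edgeCt, Nat.card_coe_set_eq, Nat.card_eq_fintype_card,
      Fintype.card_fin, Nat.choose_two_right]
  · rfl

variable {V : Type*}

theorem DependsOnEdges.mono {A : Set (SimpleGraph V)} {F F' : Set (Sym2 V)}
    (hA : DependsOnEdges A F) (h : F ⊆ F') : DependsOnEdges A F' :=
  fun _ _ hG => hA fun e he => hG e (h he)

theorem DependsOnEdges.compl {A : Set (SimpleGraph V)} {F : Set (Sym2 V)}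
    (hA : DependsOnEdges A F) : DependsOnEdges Aᶜ F :=
  fun _ _ hG h h' => h (hA (fun e he => (hG e he).symm) h')

theorem DependsOnEdges.iInter {κ : Sort*} {A : κ → Set (SimpleGraph V)} {F : Set (Sym2 V)}
    (hA : ∀ k, DependsOnEdges (A k) F) : DependsOnEdges (⋂ k, A k) F := by
  intro G G' hG h
  simp only [Set.mem_iInter] at h ⊢
  exact fun k => hA k hG (h k)

theorem DependsOnEdges.inter {A B : Set (SimpleGraph V)} {F : Set (Sym2 V)}
    (hA : DependsOnEdges A F) (hB : DependsOnEdges B F) : DependsOnEdges (A ∩ B) F :=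
  fun _ _ hG h => ⟨hA hG h.1, hB hG h.2⟩

theorem DependsOnEdges.real_biInter [Finite V] (p : I) {κ : Type*} (s : Finset κ)
    {A : κ → Set (SimpleGraph V)} {F : κ → Set (Sym2 V)}
    (hA : ∀ k ∈ s, DependsOnEdges (A k) (F k)) (hF : (s : Set κ).PairwiseDisjoint F) :
    (binomialRandom V p).real (⋂ k ∈ s, A k) = ∏ k ∈ s, (binomialRandom V p).real (A k) := by
  classical
  induction s using Finset.induction_on with
  | empty => simp
  | insert a s ha ih =>
    rw [Finset.prod_insert ha, ← ih (fun k hk => hA k (Finset.mem_insert_of_mem hk))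
      (hF.subset (by simp)), Finset.set_biInter_insert]
    refine DependsOnEdges.real_inter p (hA a (by simp)) (F' := ⋃ k ∈ s, F k) ?_ ?_
    · refine DependsOnEdges.iInter fun k => DependsOnEdges.iInter fun hk => ?_
      exact (hA k (Finset.mem_insert_of_mem hk)).mono (Set.subset_biUnion_of_mem (u := F) hk)
    · simp only [Set.disjoint_iUnion_right]
      intro k hk
      exact hF (by simp) (by simp [hk]) (by rintro rfl; exact ha hk)

/-- The pairs with one element in `X` and one in `Y`. -/
def pairsBetween (X Y : Set V) : Set (Sym2 V) := {e | ∃ x ∈ X, ∃ y ∈ Y, e = s(x, y)}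

/-- The pairs with both elements in `X`. -/
def pairsIn (X : Set V) : Set (Sym2 V) := {e | ∀ x ∈ e, x ∈ X}

theorem pairsBetween_mono {X X' Y Y' : Set V} (hX : X ⊆ X') (hY : Y ⊆ Y') :
    pairsBetween X Y ⊆ pairsBetween X' Y' := by
  rintro e ⟨x, hx, y, hy, rfl⟩
  exact ⟨x, hX hx, y, hY hy, rfl⟩

theorem pairsIn_mono {X Y : Set V} (h : X ⊆ Y) : pairsIn X ⊆ pairsIn Y :=
  fun _ he x hx => h (he x hx)

theorem pairsBetween_subset_pairsIn {X Y Z : Set V} (hX : X ⊆ Z) (hY : Y ⊆ Z) :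
    pairsBetween X Y ⊆ pairsIn Z := by
  rintro e ⟨x, hx, y, hy, rfl⟩ z hz
  rcases Sym2.mem_iff.1 hz with rfl | rfl
  exacts [hX hx, hY hy]

theorem disjoint_pairsIn_pairsBetween {X Y Z : Set V} (h : Disjoint X Y) :
    Disjoint (pairsIn X) (pairsBetween Y Z) := by
  rw [Set.disjoint_left]
  rintro e he ⟨y, hy, z, -, rfl⟩
  exact Set.disjoint_left.1 h (he y (by simp)) hy

theorem disjoint_pairsBetween {X X' Y Y' : Set V} (h : Disjoint X X' ∨ Disjoint Y Y')
    (hXY : Disjoint X Y') : Disjoint (pairsBetween X Y) (pairsBetween X' Y') := by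
  rw [Set.disjoint_left]
  rintro e ⟨x, hx, y, hy, rfl⟩ ⟨x', hx', y', hy', he⟩
  rcases Sym2.eq_iff.1 he with ⟨rfl, rfl⟩ | ⟨rfl, rfl⟩
  · rcases h with h | h
    exacts [Set.disjoint_left.1 h hx hx', Set.disjoint_left.1 h hy hy']
  · exact Set.disjoint_left.1 hXY hx hy'

/-- `v` has a neighbour in `B`. -/
def HasNbr (G : SimpleGraph V) (v : V) (B : Finset V) : Prop := ∃ b ∈ B, G.Adj v b

theorem dependsOnEdges_adj (u v : V) : DependsOnEdges {G | G.Adj u v} {s(u, v)} := by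
  intro G G' h hG
  simpa using (h s(u, v) rfl).1 hG

theorem dependsOnEdges_hasNbr (v : V) (B : Finset V) :
    DependsOnEdges {G | HasNbr G v B} (pairsBetween {v} B) := by
  rintro G G' h ⟨b, hb, hG⟩
  exact ⟨b, hb, (h s(v, b) ⟨v, rfl, b, hb, rfl⟩).1 hG⟩

theorem real_not_hasNbr [Finite V] (p : I) {v : V} {B : Finset V} (hv : v ∉ B) :
    (binomialRandom V p).real {G | ¬ HasNbr G v B} = (1 - p : ℝ) ^ B.card := by
  have h : {G : SimpleGraph V | ¬ HasNbr G v B} = ⋂ b ∈ B, {G | G.Adj v b}ᶜ := by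
    ext G; simp [HasNbr]
  rw [h, DependsOnEdges.real_biInter p B (F := fun b => {s(v, b)})
    (fun b _ => (dependsOnEdges_adj v b).compl), Finset.prod_congr rfl (g := fun _ => (1 - p : ℝ)),
    Finset.prod_const]
  · intro b hb
    rw [probReal_compl_eq_one_sub (measurableSet_simpleGraph _),
      binomialRandom_real_adj p (by rintro rfl; exact hv hb)]
  · intro b hb c _ hbc
    simp only [Function.onFun, Set.disjoint_singleton, ne_eq, Sym2.eq_iff, not_or, not_and]
    exact ⟨fun _ => hbc, by rintro rfl rfl; exact hv hb⟩

theorem real_hasNbr [Finite V] (p : I) {v : V} {B : Finset V} (hv : v ∉ B) :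
    (binomialRandom V p).real {G | HasNbr G v B} = 1 - (1 - p : ℝ) ^ B.card := by
  rw [← real_not_hasNbr p hv, ← probReal_compl_eq_one_sub (measurableSet_simpleGraph _)]
  congr 1; ext; simp

/-- The blocks of the family `B` in which `v` has a neighbour are exactly those indexed by `s`. -/
def HasCode {ι : Type*} (G : SimpleGraph V) (B : ι → Finset V) (v : V) (s : Finset ι) : Prop :=
  ∀ i, HasNbr G v (B i) ↔ i ∈ s

theorem dependsOnEdges_hasCode {ι : Type*} (B : ι → Finset V) (v : V) (s : Finset ι) :
    DependsOnEdges {G | HasCode G B v s} (pairsBetween {v} (⋃ i, (B i : Set V))) := by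
  have h : {G : SimpleGraph V | HasCode G B v s} = ⋂ i, {G | HasNbr G v (B i) ↔ i ∈ s} := by
    ext G; simp [HasCode]
  rw [h]
  refine DependsOnEdges.iInter fun i => ?_
  have h1 := (dependsOnEdges_hasNbr v (B i)).mono (pairsBetween_mono subset_rfl
    (Set.subset_iUnion (fun i => (B i : Set V)) i))
  by_cases hi : i ∈ s
  · simpa [hi] using h1
  · simpa [hi, Set.compl_def] using h1.compl

theorem real_hasCode [Finite V] (p : I) {ι : Type*} [Fintype ι] [DecidableEq ι]
    {B : ι → Finset V} {v : V}
    (hB : Pairwise fun i j => Disjoint (B i) (B j)) (hv : ∀ i, v ∉ B i) (s : Finset ι) :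
    (binomialRandom V p).real {G | HasCode G B v s} =
      ∏ i, if i ∈ s then 1 - (1 - p : ℝ) ^ (B i).card else (1 - p : ℝ) ^ (B i).card := by
  have h : {G : SimpleGraph V | HasCode G B v s} =
      ⋂ i ∈ Finset.univ, {G | HasNbr G v (B i) ↔ i ∈ s} := by
    ext G; simp [HasCode]
  rw [h, DependsOnEdges.real_biInter p _ (F := fun i => pairsBetween {v} (B i))]
  · refine Finset.prod_congr rfl fun i _ => ?_
    split_ifs with hi
    · simp only [hi, iff_true]; exact real_hasNbr p (hv i)
    · simp only [hi, iff_false]; exact real_not_hasNbr p (hv i)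
  · intro i _
    by_cases hi : i ∈ s
    · simpa [hi] using dependsOnEdges_hasNbr v (B i)
    · simpa [hi, Set.compl_def] using (dependsOnEdges_hasNbr v (B i)).compl
  · intro i _ j _ hij
    exact disjoint_pairsBetween (.inr (by simpa using hB hij)) (by simpa using hv j)

/-- If every vertex has a given code with probability at least `θ r`, then it is unlikely that
some requirement `r` is met by no candidate vertex in `C r`. -/
theorem real_exists_forall_not_hasCode_le [Finite V] (p : I) {ι R : Type*} [Fintype R]
    (B : ι → Finset V) (C : R → Finset V) (s : R → Finset ι) {θ : ℝ} {h : ℕ} (hθ : θ ≤ 1)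
    (hC : ∀ r, h ≤ (C r).card) (hCB : ∀ r, ∀ v ∈ C r, ∀ i, v ∉ B i)
    (hp : ∀ r, ∀ v ∈ C r, θ ≤ (binomialRandom V p).real {G | HasCode G B v (s r)})
    (hθ0 : 0 ≤ θ) :
    (binomialRandom V p).real {G | ∃ r, ∀ v ∈ C r, ¬ HasCode G B v (s r)} ≤
      Fintype.card R * (1 - θ) ^ h := by
  have h1 : {G : SimpleGraph V | ∃ r, ∀ v ∈ C r, ¬ HasCode G B v (s r)} =
      ⋃ r, ⋂ v ∈ C r, {G | HasCode G B v (s r)}ᶜ := by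
    ext G; simp
  rw [h1]
  refine (measureReal_iUnion_fintype_le _).trans ?_
  rw [← nsmul_eq_mul, ← Finset.card_univ]
  refine Finset.sum_le_card_nsmul _ _ _ fun r _ => ?_
  rw [DependsOnEdges.real_biInter p (C r)
    (F := fun v => pairsBetween {v} (⋃ i, (B i : Set V)))
    (fun v _ => (dependsOnEdges_hasCode B v (s r)).compl)]
  · refine (Finset.prod_le_prod (g := fun _ => 1 - θ) (fun _ _ => measureReal_nonneg)
      fun v hv => ?_).trans ?_
    · rw [probReal_compl_eq_one_sub (measurableSet_simpleGraph _)]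
      linarith [hp r v hv]
    · rw [Finset.prod_const]
      exact pow_le_pow_of_le_one (by linarith) (by linarith) (hC r)
  · intro v hv w _ hvw
    exact disjoint_pairsBetween (.inl (by simpa using hvw)) (by simpa using hCB r v hv)

/-- Two fixed vertices are unlikely to see the same blocks. -/
theorem real_same_code_le [Finite V] (p : I) {ι : Type*} [Fintype ι] {B : ι → Finset V} {s : ℕ}
    (hs : ∀ i, (B i).card = s) (hB : Pairwise fun i j => Disjoint (B i) (B j)) {v w : V}
    (hvw : v ≠ w) (hv : ∀ i, v ∉ B i) (hw : ∀ i, w ∉ B i) :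
    (binomialRandom V p).real {G | ∀ i, HasNbr G v (B i) ↔ HasNbr G w (B i)} ≤
      (1 - (1 - (1 - p : ℝ) ^ s) * (1 - p : ℝ) ^ s) ^ Fintype.card ι := by
  classical
  calc (binomialRandom V p).real {G | ∀ i, HasNbr G v (B i) ↔ HasNbr G w (B i)}
      ≤ (binomialRandom V p).real
        (⋂ i ∈ Finset.univ, ({G | HasNbr G v (B i)} ∩ {G | HasNbr G w (B i)}ᶜ)ᶜ) := by
        refine measureReal_mono fun G hG => ?_
        simp only [Set.mem_iInter]
        rintro i - ⟨h1, h2⟩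
        exact h2 ((hG i).1 h1)
    _ = _ := by
        rw [DependsOnEdges.real_biInter p _ (F := fun i => pairsBetween {v, w} (B i)),
          ← Finset.card_univ]
        · refine Finset.prod_eq_pow_card fun i _ => ?_
          rw [probReal_compl_eq_one_sub (measurableSet_simpleGraph _),
            DependsOnEdges.real_inter p (dependsOnEdges_hasNbr v (B i))
              (dependsOnEdges_hasNbr w (B i)).compl, real_hasNbr p (hv i), ← hs i,
            ← real_not_hasNbr p (hw i)]
          · rfl
          · exact disjoint_pairsBetween (.inl (by simpa using hvw)) (by simpa using hv i)
        · intro i _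
          exact (((dependsOnEdges_hasNbr v (B i)).mono
            (pairsBetween_mono (by simp) subset_rfl)).inter
            ((dependsOnEdges_hasNbr w (B i)).compl.mono
              (pairsBetween_mono (by simp) subset_rfl))).compl
        · intro i _ j _ hij
          refine disjoint_pairsBetween (.inr (by simpa using hB hij)) ?_
          simp [hv j, hw j]

/-- Choosing data `d` with `Φ d` by exposing the edges in `F`, and then requiring `Ψ d`, which
depends on the edges in `F'` only. -/
theorem real_exists_and_ge [Finite V] (p : I) {D : Type*} {Φ Ψ : D → Set (SimpleGraph V)}
    {F F' : Set (Sym2 V)} {δ : ℝ} (hδ : 0 ≤ δ) (hF : Disjoint F F')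
    (hΦ : ∀ d, DependsOnEdges (Φ d) F)
    (hΨ : ∀ d, (Φ d).Nonempty → DependsOnEdges (Ψ d) F')
    (hp : ∀ d, (Φ d).Nonempty → (binomialRandom V p).real (Ψ d)ᶜ ≤ δ) :
    (binomialRandom V p).real (⋃ d, Φ d ∩ Ψ d)ᶜ ≤
      (binomialRandom V p).real (⋃ d, Φ d)ᶜ + δ := by
  classical
  have := Fintype.ofFinite V
  by_cases hne : ∃ d, (Φ d).Nonempty
  swap
  · simp only [not_exists, Set.not_nonempty_iff_eq_empty] at hne
    simpa [hne] using hδ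
  obtain ⟨d₀, hd₀⟩ := hne
  let c : SimpleGraph V → D := fun G =>
    if h : {d | G ∈ Φ d}.Nonempty then h.some else d₀
  have hc : ∀ G, (∃ d, G ∈ Φ d) → G ∈ Φ (c G) := by
    intro G h
    have h' : {d | G ∈ Φ d}.Nonempty := h
    simp only [c, dif_pos h']
    exact h'.some_mem
  have hcongr : ∀ G G', (∀ e ∈ F, e ∈ G.edgeSet ↔ e ∈ G'.edgeSet) → c G = c G' := by
    intro G G' h
    have : {d | G ∈ Φ d} = {d | G' ∈ Φ d} := by
      ext d
      exact ⟨hΦ d h, hΦ d fun e he => (h e he).symm⟩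
    simp only [c, this]
  let E : D → Set (SimpleGraph V) := fun d => {G | G ∈ Φ d ∧ c G = d}
  have hE : ∀ d, DependsOnEdges (E d) F := by
    rintro d G G' h ⟨h1, h2⟩
    exact ⟨hΦ d h h1, (hcongr G G' h).symm.trans h2⟩
  let S := Finset.univ.image c
  have hsub : (⋃ d, Φ d ∩ Ψ d)ᶜ ⊆ (⋃ d, Φ d)ᶜ ∪ ⋃ d ∈ S, E d ∩ (Ψ d)ᶜ := by
    intro G hG
    by_cases h : ∃ d, G ∈ Φ d
    · refine .inr (Set.mem_biUnion (x := c G) (by simp [S]) ⟨⟨hc G h, rfl⟩, fun h' => hG ?_⟩)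
      exact Set.mem_iUnion.2 ⟨c G, hc G h, h'⟩
    · exact .inl (by simpa using h)
  refine (measureReal_mono hsub).trans <| (measureReal_union_le _ _).trans ?_
  gcongr
  calc (binomialRandom V p).real (⋃ d ∈ S, E d ∩ (Ψ d)ᶜ)
      ≤ ∑ d ∈ S, (binomialRandom V p).real (E d ∩ (Ψ d)ᶜ) := measureReal_biUnion_finset_le _ _
    _ ≤ ∑ d ∈ S, (binomialRandom V p).real (E d) * δ := by
        refine Finset.sum_le_sum fun d _ => ?_
        by_cases hd : (Φ d).Nonempty
        · rw [DependsOnEdges.real_inter p (hE d) (hΨ d hd).compl hF]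
          exact mul_le_mul_of_nonneg_left (hp d hd) measureReal_nonneg
        · have : E d = ∅ := by
            rw [Set.not_nonempty_iff_eq_empty] at hd
            simp [E, hd]
          simp [this]
    _ = (binomialRandom V p).real (⋃ d ∈ S, E d) * δ := by
        rw [← Finset.sum_mul, measureReal_biUnion_finset]
        · intro d _ d' _ hdd'
          refine Set.disjoint_left.2 fun G h h' => hdd' (h.2.symm.trans h'.2)
        · exact fun d _ => measurableSet_simpleGraph _
    _ ≤ δ := mul_le_of_le_one_left hδ measureReal_le_one

theorem HasNbr.congr {G G' : SimpleGraph V} {v : V} {B : Finset V} {F : Set (Sym2 V)}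
    (h : ∀ e ∈ F, e ∈ G.edgeSet ↔ e ∈ G'.edgeSet) (hF : pairsBetween {v} B ⊆ F) :
    HasNbr G v B ↔ HasNbr G' v B :=
  ⟨dependsOnEdges_hasNbr v B fun e he => h e (hF he),
    dependsOnEdges_hasNbr v B fun e he => (h e (hF he)).symm⟩

theorem HasCode.congr {ι : Type*} {G G' : SimpleGraph V} {B : ι → Finset V} {v : V} {s : Finset ι}
    {F : Set (Sym2 V)} (h : ∀ e ∈ F, e ∈ G.edgeSet ↔ e ∈ G'.edgeSet)
    (hF : ∀ i, pairsBetween {v} (B i) ⊆ F) : HasCode G B v s ↔ HasCode G' B v s :=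
  forall_congr' fun i => by rw [HasNbr.congr h (hF i)]

theorem one_half_le_one_sub_pow {p : ℝ} {N : ℕ} (h1 : p ≤ 1) (hN : p * N ≤ 1 / 2) :
    1 / 2 ≤ (1 - p) ^ N := by
  have := one_add_mul_le_pow (a := -p) (by linarith) N
  rw [← sub_eq_add_neg] at this
  linarith

theorem one_sub_pow_le_exp {x : ℝ} (hx : x ≤ 1) (N : ℕ) : (1 - x) ^ N ≤ Real.exp (-(x * N)) := by
  have := pow_le_pow_left₀ (by linarith) (Real.one_sub_le_exp_neg x) N
  rwa [← Real.exp_nat_mul, mul_neg, mul_comm] at this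

theorem half_mul_le_one_sub_pow {p : ℝ} {N : ℕ} (h0 : 0 ≤ p) (h1 : p ≤ 1) (hN : p * N ≤ 1) :
    p * N / 2 ≤ 1 - (1 - p) ^ N := by
  have h2 := one_sub_pow_le_exp h1 N
  have h3 : Real.exp (-(p * N)) ≤ 1 - p * N / 2 := by
    have h4 : 0 ≤ p * N := by positivity
    have h5 := Real.add_one_le_exp (p * N)
    rw [Real.exp_neg]
    refine inv_le_of_inv_le₀ (by linarith) (le_trans ?_ h5)
    rw [inv_le_iff_one_le_mul₀ (by linarith)]
    nlinarith
  linarith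

theorem le_real_hasCode [Finite V] (p : I) {ι : Type*} [Fintype ι] {B : ι → Finset V} {v : V}
    {x y : ℕ} (hB : Pairwise fun i j => Disjoint (B i) (B j)) (hv : ∀ i, v ∉ B i) (s : Finset ι)
    (hx : ∀ i, x ≤ (B i).card) (hy : ∀ i, (B i).card ≤ y)
    (hpx : (p : ℝ) * x ≤ 1) (hpy : (p : ℝ) * (y * Fintype.card ι) ≤ 1 / 2) :
    (p * x / 2 : ℝ) ^ s.card / 2 ≤ (binomialRandom V p).real {G | HasCode G B v s} := by
  classical
  have hp0 : (0 : ℝ) ≤ p := p.2.1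
  have hp1 : (p : ℝ) ≤ 1 := p.2.2
  have hq0 : (0 : ℝ) ≤ 1 - p := by linarith
  have hq1 : (1 : ℝ) - p ≤ 1 := by linarith
  rw [real_hasCode p hB hv]
  calc (p * x / 2 : ℝ) ^ s.card / 2
      ≤ (p * x / 2 : ℝ) ^ s.card * (1 - p : ℝ) ^ (y * Fintype.card ι) := by
        rw [div_eq_mul_one_div]
        gcongr
        exact one_half_le_one_sub_pow hp1 (by exact_mod_cast hpy)
    _ = ∏ i, (if i ∈ s then (p * x / 2 : ℝ) else 1) * (1 - p : ℝ) ^ y := by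
        rw [Finset.prod_mul_distrib, Finset.prod_ite_mem, Finset.univ_inter, Finset.prod_const,
          Finset.prod_const, Finset.card_univ, pow_mul]
    _ ≤ _ := by
        refine Finset.prod_le_prod (fun i _ => ?_) fun i _ => ?_
        · split_ifs <;> positivity
        · split_ifs
          · refine (mul_le_of_le_one_right (by positivity) (pow_le_one₀ hq0 hq1)).trans ?_
            refine (half_mul_le_one_sub_pow hp0 hp1 hpx).trans ?_
            gcongr 1 - ?_
            exact pow_le_pow_of_le_one hq0 hq1 (hx i)
          · rw [one_mul]
            exact pow_le_pow_of_le_one hq0 hq1 (hy i)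

/-- A finset contains any number of disjoint chunks of a given size, if the sizes permit. -/
theorem exists_disjoint_chunks (X : Finset V) {s h : ℕ} (hX : s * h ≤ X.card) :
    ∃ C : Fin s → Finset V, (∀ c, C c ⊆ X) ∧ (∀ c, (C c).card = h) ∧
      Pairwise fun c c' => Disjoint (C c) (C c') := by
  classical
  obtain ⟨f⟩ := Function.Embedding.nonempty_of_card_le (α := Fin s × Fin h) (β := X) (by simpa)
  refine ⟨fun c => Finset.univ.image fun x => (f (c, x) : V), fun c v => ?_, fun c => ?_,
    fun c c' hc => ?_⟩
  · simp only [Finset.mem_image, Finset.mem_univ, true_and]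
    rintro ⟨x, rfl⟩
    exact (f (c, x)).2
  · rw [Finset.card_image_of_injective]
    · simp
    · intro x y hxy
      simpa using f.injective (Subtype.ext hxy)
  · refine Finset.disjoint_left.2 ?_
    simp only [Finset.mem_image, Finset.mem_univ, true_and]
    rintro v ⟨x, rfl⟩ ⟨y, hy⟩
    have := f.injective (Subtype.ext hy)
    simp only [Prod.mk.injEq] at this
    exact hc this.1.symm

/-- The vertices in the first levels of a family of parts. -/
def levelsUpTo (parts : ℕ → Finset V) (l : ℕ) : Set V := {v | ∃ l' ≤ l, v ∈ parts l'}

theorem subset_levelsUpTo {parts : ℕ → Finset V} {l l' : ℕ} (h : l' ≤ l) {B : Finset V}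
    (hB : B ⊆ parts l') : (B : Set V) ⊆ levelsUpTo parts l :=
  fun _ hv => ⟨l', h, hB hv⟩

theorem levelsUpTo_mono (parts : ℕ → Finset V) {l l' : ℕ} (h : l ≤ l') :
    levelsUpTo parts l ⊆ levelsUpTo parts l' :=
  fun _ ⟨k, hk, hv⟩ => ⟨k, hk.trans h, hv⟩

theorem disjoint_levelsUpTo {parts : ℕ → Finset V}
    (hparts : Pairwise fun l l' => Disjoint (parts l) (parts l')) {l l' : ℕ} (h : l < l') :
    Disjoint (levelsUpTo parts l) (parts l' : Set V) := by
  rw [Set.disjoint_left]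
  rintro v ⟨k, hk, hv⟩ hv'
  exact Finset.disjoint_left.1 (hparts (by omega)) hv hv'

/-- The blocks `B k i`, `k ≤ l`, sit in the parts, have the right sizes, and a vertex of
`B (k + 1) i` sees exactly the block `B k i` among the blocks on level `k`. -/
structure IsBlockTower {a : ℕ} (G : SimpleGraph V) (parts : ℕ → Finset V) (s : ℕ → ℕ)
    (B : ℕ → Fin a → Finset V) (l : ℕ) : Prop where
  subset : ∀ k ≤ l, ∀ i, B k i ⊆ parts k
  card : ∀ k ≤ l, ∀ i, (B k i).card = s k
  disjoint : ∀ k ≤ l, Pairwise fun i i' => Disjoint (B k i) (B k i')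
  code : ∀ k < l, ∀ i, ∀ v ∈ B (k + 1) i, HasCode G (B k) v {i}

section Tower

variable {a : ℕ} {parts : ℕ → Finset V} {s : ℕ → ℕ} {l : ℕ}

theorem dependsOnEdges_isBlockTower (B : ℕ → Fin a → Finset V) :
    DependsOnEdges {G | IsBlockTower G parts s B l} (pairsIn (levelsUpTo parts l)) := by
  rintro G G' h ⟨h1, h2, h3, h4⟩
  refine ⟨h1, h2, h3, fun k hk i v hv => (HasCode.congr h fun i' => ?_).1 (h4 k hk i v hv)⟩
  refine pairsBetween_subset_pairsIn ?_ (subset_levelsUpTo hk.le (h1 k hk.le i'))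
  exact Set.singleton_subset_iff.2 ⟨k + 1, hk, h1 (k + 1) hk i hv⟩

theorem exists_isBlockTower_zero [DecidableEq V] (ha : a ≤ (parts 0).card) (hs : s 0 = 1)
    (G : SimpleGraph V) : ∃ B : ℕ → Fin a → Finset V, IsBlockTower G parts s B 0 := by
  obtain ⟨C, hC, hC', hCdisj⟩ := exists_disjoint_chunks (parts 0) (s := a) (h := 1) (by simpa)
  refine ⟨fun _ => C, ?_, ?_, ?_, by simp⟩ <;> intro k hk <;> obtain rfl : k = 0 := by omega
  exacts [hC, hs ▸ hC', hCdisj]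

/-- One more level of blocks can be found with high probability. -/
theorem real_isBlockTower_succ_le [Finite V] (p : I)
    (hparts : Pairwise fun l l' => Disjoint (parts l) (parts l')) {h : ℕ}
    (hcard : s (l + 1) * h ≤ (parts (l + 1)).card)
    (h1 : (p : ℝ) * s l ≤ 1) (h2 : (p : ℝ) * (s l * a) ≤ 1 / 2) :
    (binomialRandom V p).real
      (⋃ B : ℕ → Fin a → Finset V, {G | IsBlockTower G parts s B (l + 1)})ᶜ ≤
      (binomialRandom V p).real (⋃ B : ℕ → Fin a → Finset V, {G | IsBlockTower G parts s B l})ᶜ +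
      a * s (l + 1) * (1 - p * s l / 4) ^ h := by
  classical
  have := Fintype.ofFinite V
  have hps : 0 ≤ (p : ℝ) * s l := mul_nonneg p.2.1 (by positivity)
  let Ψ : (ℕ → Fin a → Finset V) → Set (SimpleGraph V) := fun B =>
    {G | ∃ B' : Fin a → Finset V, (∀ i, B' i ⊆ parts (l + 1)) ∧ (∀ i, (B' i).card = s (l + 1)) ∧
      (Pairwise fun i i' => Disjoint (B' i) (B' i')) ∧ ∀ i, ∀ v ∈ B' i, HasCode G (B l) v {i}}
  have hsub : (⋃ B : ℕ → Fin a → Finset V, {G | IsBlockTower G parts s B (l + 1)})ᶜ ⊆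
      (⋃ B : ℕ → Fin a → Finset V, {G | IsBlockTower G parts s B l} ∩ Ψ B)ᶜ := by
    refine Set.compl_subset_compl.2 (Set.iUnion_subset ?_)
    rintro B G ⟨hB, B', h1, h2, h3, h4⟩
    refine Set.mem_iUnion.2 ⟨Function.update B (l + 1) B', ⟨?_, ?_, ?_, ?_⟩⟩
    · intro k hk
      rcases hk.lt_or_eq with hk | rfl
      · rw [Function.update_of_ne hk.ne]; exact hB.subset k (by omega)
      · simpa using h1
    · intro k hk
      rcases hk.lt_or_eq with hk | rfl
      · rw [Function.update_of_ne hk.ne]; exact hB.card k (by omega)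
      · simpa using h2
    · intro k hk
      rcases hk.lt_or_eq with hk | rfl
      · rw [Function.update_of_ne hk.ne]; exact hB.disjoint k (by omega)
      · simpa using h3
    · intro k hk
      rw [Function.update_of_ne hk.ne]
      rcases (Nat.lt_succ_iff.1 hk).lt_or_eq with hk | rfl
      · rw [Function.update_of_ne (by omega)]; exact hB.code k hk
      · simpa using h4
  refine (measureReal_mono hsub).trans (real_exists_and_ge p
    (F := pairsIn (levelsUpTo parts l))
    (F' := pairsBetween (parts (l + 1)) (levelsUpTo parts l)) ?_ ?_
    dependsOnEdges_isBlockTower ?_ ?_)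
  · have : (0 : ℝ) ≤ 1 - p * s l / 4 := by linarith
    positivity
  · exact disjoint_pairsIn_pairsBetween (disjoint_levelsUpTo hparts (by omega))
  · rintro B ⟨G₀, hB⟩ G G' h ⟨B', h1, h2, h3, h4⟩
    refine ⟨B', h1, h2, h3, fun i v hv => (HasCode.congr h fun i' => ?_).1 (h4 i v hv)⟩
    exact pairsBetween_mono (by simpa using h1 i hv)
      (subset_levelsUpTo le_rfl (hB.subset l le_rfl i'))
  · rintro B ⟨G₀, hB⟩
    obtain ⟨C, hC, hC', hCdisj⟩ := exists_disjoint_chunks (parts (l + 1)) hcard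
    have hCB : ∀ c, ∀ v ∈ C c, ∀ i, v ∉ B l i := fun c v hv i hv' =>
      Finset.disjoint_left.1 (hparts (show l + 1 ≠ l by omega)) (hC c hv)
        (hB.subset l le_rfl i hv')
    have key := real_exists_forall_not_hasCode_le p (R := Fin a × Fin (s (l + 1))) (B l)
      (fun r => C r.2) (fun r => {r.1}) (θ := p * s l / 4) (h := h) (by linarith)
      (fun r => (hC' r.2).ge) (fun r => hCB r.2) ?_ (by positivity)
    · refine le_trans (measureReal_mono ?_) (key.trans (by simp))
      intro G hG
      by_contra hG'
      simp only [Set.mem_ofPred_eq, not_exists, not_forall, not_not] at hG'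
      choose v hv hcode using hG'
      refine hG ⟨fun i => Finset.univ.image fun c => v (i, c), ?_, ?_, ?_, ?_⟩
      · intro i w
        simp only [Finset.mem_image, Finset.mem_univ, true_and]
        rintro ⟨c, rfl⟩
        exact hC c (hv (i, c))
      · intro i
        rw [Finset.card_image_of_injective, Finset.card_univ, Fintype.card_fin]
        intro c c' hcc'
        by_contra hne
        exact Finset.disjoint_left.1 (hCdisj hne) (hv (i, c)) (by
          simp only at hcc'; rw [hcc']; exact hv (i, c'))
      · intro i i' hii'
        refine Finset.disjoint_left.2 ?_
        simp only [Finset.mem_image, Finset.mem_univ, true_and]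
        rintro w ⟨c, rfl⟩ ⟨c', h'⟩
        have e1 := (hcode (i, c) i).2 (by simp)
        rw [← h', hcode (i', c') i] at e1
        exact hii' (by simpa using e1)
      · intro i w
        simp only [Finset.mem_image, Finset.mem_univ, true_and]
        rintro ⟨c, rfl⟩
        exact hcode (i, c)
    · rintro ⟨i, c⟩ v hv
      have := le_real_hasCode p (x := s l) (y := s l) (hB.disjoint l le_rfl) (hCB c v hv) {i}
        (fun i => (hB.card l le_rfl i).ge) (fun i => (hB.card l le_rfl i).le) h1 (by simpa using h2)
      refine le_trans (le_of_eq ?_) this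
      rw [Finset.card_singleton]; ring

/-- The blocks of two consecutive levels, as a single family. -/
def blockPair (B : ℕ → Fin a → Finset V) (l : ℕ) (x : Fin a × Bool) : Finset V :=
  if x.2 then B (l + 1) x.1 else B l x.1

/-- For every pair `(i, k)` some vertex sees exactly the `i`-th block on level `l + 1` and the
`k`-th block on level `l`. -/
def HasMiddles (G : SimpleGraph V) (parts : ℕ → Finset V) (B : ℕ → Fin a → Finset V)
    (l : ℕ) : Prop :=
  ∀ i k : Fin a, ∃ m ∈ parts (l + 3), HasCode G (blockPair B l) m {(i, true), (k, false)}

/-- The vertices of `D` are distinguished by the blocks they see. -/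
def Separates {ι : Type*} (G : SimpleGraph V) (B : ι → Finset V) (D : Finset V) : Prop :=
  ∀ v ∈ D, ∀ w ∈ D, v ≠ w → ¬ ∀ i, HasNbr G v (B i) ↔ HasNbr G w (B i)

theorem IsBlockTower.blockPair_subset {G : SimpleGraph V} {B : ℕ → Fin a → Finset V}
    (h : IsBlockTower G parts s B (l + 2)) (x : Fin a × Bool) :
    (blockPair B l x : Set V) ⊆ levelsUpTo parts (l + 2) := by
  unfold blockPair
  split_ifs
  · exact subset_levelsUpTo (by omega) (h.subset (l + 1) (by omega) _)
  · exact subset_levelsUpTo (by omega) (h.subset l (by omega) _)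

theorem IsBlockTower.pairwise_disjoint_blockPair {G : SimpleGraph V} {B : ℕ → Fin a → Finset V}
    (hparts : Pairwise fun l l' => Disjoint (parts l) (parts l'))
    (h : IsBlockTower G parts s B (l + 2)) :
    Pairwise fun x y => Disjoint (blockPair B l x) (blockPair B l y) := by
  have h' : ∀ i k, Disjoint (B (l + 1) i) (B l k) := fun i k =>
    (hparts (show l + 1 ≠ l by omega)).mono (h.subset (l + 1) (by omega) i)
      (h.subset l (by omega) k)
  rintro ⟨i, b⟩ ⟨k, c⟩ hne
  cases b <;> cases c <;> simp only [blockPair, if_true, Bool.false_eq_true, if_false]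
  · exact h.disjoint l (by omega) (by simpa using hne)
  · exact (h' _ _).symm
  · exact h' _ _
  · exact h.disjoint (l + 1) (by omega) (by simpa using hne)

/-- If the tower exists, the middle vertices exist with high probability. -/
theorem real_hasMiddles_le [Finite V] (p : I)
    (hparts : Pairwise fun l l' => Disjoint (parts l) (parts l')) {M : ℕ}
    (hs : s l ≤ s (l + 1)) (hcard : M ≤ (parts (l + 3)).card)
    (h1 : (p : ℝ) * s (l + 1) * (4 * a) ≤ 1) :
    (binomialRandom V p).real (⋃ B : ℕ → Fin a → Finset V,
        {G | IsBlockTower G parts s B (l + 2)} ∩ {G | HasMiddles G parts B l})ᶜ ≤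
      (binomialRandom V p).real
        (⋃ B : ℕ → Fin a → Finset V, {G | IsBlockTower G parts s B (l + 2)})ᶜ +
      a ^ 2 * (1 - (p * s l) ^ 2 / 8) ^ M := by
  classical
  have := Fintype.ofFinite V
  rcases Nat.eq_zero_or_pos a with rfl | ha
  · refine le_add_of_le_of_nonneg (measureReal_mono ?_) (by simp)
    refine Set.compl_subset_compl.2 (Set.iUnion_mono fun B G hG => ⟨hG, fun i => i.elim0⟩)
  have ha' : (1 : ℝ) ≤ a := by exact_mod_cast ha
  have hps : 0 ≤ (p : ℝ) * s l := mul_nonneg p.2.1 (by positivity)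
  have hps' : (p : ℝ) * s l ≤ p * s (l + 1) := by
    gcongr
    exact p.2.1
  have hps1 : (p : ℝ) * s l ≤ 1 := by nlinarith
  have hsq : ((p : ℝ) * s l) ^ 2 ≤ 1 := pow_le_one₀ hps hps1
  refine real_exists_and_ge p
    (F := pairsIn (levelsUpTo parts (l + 2)))
    (F' := pairsBetween (parts (l + 3)) (levelsUpTo parts (l + 2))) ?_ ?_
    dependsOnEdges_isBlockTower ?_ ?_
  · have : (0 : ℝ) ≤ 1 - (p * s l) ^ 2 / 8 := by linarith
    positivity
  · exact disjoint_pairsIn_pairsBetween (disjoint_levelsUpTo hparts (by omega))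
  · rintro B ⟨G₀, hB⟩ G G' h hG i k
    obtain ⟨m, hm, hm'⟩ := hG i k
    refine ⟨m, hm, (HasCode.congr h fun x => ?_).1 hm'⟩
    exact pairsBetween_mono (by simpa using hm) (IsBlockTower.blockPair_subset hB x)
  · rintro B ⟨G₀, hB : IsBlockTower G₀ _ _ _ _⟩
    have hm : ∀ m ∈ parts (l + 3), ∀ x, m ∉ blockPair B l x := fun m hm x hmx =>
      Set.disjoint_left.1 (disjoint_levelsUpTo hparts (show l + 2 < l + 3 by omega))
        (hB.blockPair_subset x hmx) hm
    have key := real_exists_forall_not_hasCode_le p (R := Fin a × Fin a) (blockPair B l)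
      (fun _ => parts (l + 3)) (fun r => {(r.1, true), (r.2, false)}) (θ := (p * s l) ^ 2 / 8)
      (h := M) (by linarith) (fun _ => hcard) (fun _ => hm) ?_ (by positivity)
    · refine le_trans (le_of_eq ?_) (key.trans (by simp [sq]))
      congr 1
      ext G
      simp [HasMiddles]
    · rintro ⟨i, k⟩ m hmem
      have := le_real_hasCode p (x := s l) (y := s (l + 1)) (hB.pairwise_disjoint_blockPair hparts)
        (hm m hmem) {(i, true), (k, false)} ?_ ?_ hps1 ?_
      · refine le_trans (le_of_eq ?_) this
        rw [Finset.card_pair (by simp)]; ring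
      · intro x
        unfold blockPair
        split_ifs
        · rwa [hB.card _ (by omega)]
        · rw [hB.card _ (by omega)]
      · intro x
        unfold blockPair
        split_ifs
        · rw [hB.card _ (by omega)]
        · rwa [hB.card _ (by omega)]
      · simp only [Fintype.card_prod, Fintype.card_fin, Fintype.card_bool]
        push_cast
        linarith

/-- The vertices of a set `D` away from the tower are separated with high probability. -/
theorem real_separates_le [Fintype V] (p : I) (D : Finset V)
    (hD : ∀ k, Disjoint D (parts k)) (h1 : (p : ℝ) * s (l + 2) ≤ 1 / 2) :
    (binomialRandom V p).real (⋃ B : ℕ → Fin a → Finset V,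
        ({G | IsBlockTower G parts s B (l + 2)} ∩ {G | HasMiddles G parts B l}) ∩
          {G | Separates G (B (l + 2)) D})ᶜ ≤
      (binomialRandom V p).real (⋃ B : ℕ → Fin a → Finset V,
        {G | IsBlockTower G parts s B (l + 2)} ∩ {G | HasMiddles G parts B l})ᶜ +
      Fintype.card V ^ 2 * (1 - p * s (l + 2) / 4) ^ a := by
  classical
  have hp0 : (0 : ℝ) ≤ p := p.2.1
  have hp1 : (p : ℝ) ≤ 1 := p.2.2
  have hps : 0 ≤ (p : ℝ) * s (l + 2) := by positivity
  refine real_exists_and_ge p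
    (F := pairsIn (levelsUpTo parts (l + 3)))
    (F' := pairsBetween D (levelsUpTo parts (l + 2))) ?_ ?_ ?_ ?_ ?_
  · have : (0 : ℝ) ≤ 1 - p * s (l + 2) / 4 := by linarith
    positivity
  · refine disjoint_pairsIn_pairsBetween (Set.disjoint_left.2 ?_)
    rintro v ⟨k, -, hv⟩ hv'
    exact Finset.disjoint_left.1 (hD k) hv' hv
  · rintro B G G' h ⟨hB, hG⟩
    refine ⟨(dependsOnEdges_isBlockTower B).mono (pairsIn_mono (levelsUpTo_mono parts
      (by omega))) h hB, fun i k => ?_⟩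
    obtain ⟨m, hm, hm'⟩ := hG i k
    refine ⟨m, hm, (HasCode.congr h fun x => pairsBetween_subset_pairsIn ?_ ?_).1 hm'⟩
    · exact Set.singleton_subset_iff.2 ⟨l + 3, le_rfl, hm⟩
    · exact (hB.blockPair_subset x).trans (levelsUpTo_mono parts (by omega))
  · rintro B ⟨G₀, hB, -⟩ G G' h hG v hv w hw hvw
    have key : ∀ u ∈ D, ∀ i, HasNbr G u (B (l + 2) i) ↔ HasNbr G' u (B (l + 2) i) := fun u hu i =>
      HasNbr.congr h (pairsBetween_mono (by simpa using hu)
        (subset_levelsUpTo le_rfl (hB.subset (l + 2) le_rfl i)))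
    simpa only [key v hv, key w hw] using hG v hv w hw hvw
  · rintro B ⟨G₀, hB, -⟩
    have hDB : ∀ v ∈ D, ∀ i, v ∉ B (l + 2) i := fun v hv i hvi =>
      Finset.disjoint_left.1 (hD _) hv (hB.subset (l + 2) le_rfl i hvi)
    have hsub : {G : SimpleGraph V | Separates G (B (l + 2)) D}ᶜ ⊆
        ⋃ x ∈ D.offDiag, {G | ∀ i, HasNbr G x.1 (B (l + 2) i) ↔ HasNbr G x.2 (B (l + 2) i)} := by
      intro G hG
      simp only [Separates, Set.mem_compl_iff, Set.mem_ofPred_eq, not_forall] at hG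
      obtain ⟨v, hv, w, hw, hvw, hG⟩ := hG
      exact Set.mem_biUnion (x := (v, w)) (by simp [hv, hw, hvw]) (not_exists_not.1 hG)
    refine (measureReal_mono hsub (measure_ne_top _ _)).trans <|
      (measureReal_biUnion_finset_le _ _).trans ?_
    have hx : (p : ℝ) * s (l + 2) / 2 ≤ 1 - (1 - p : ℝ) ^ s (l + 2) :=
      half_mul_le_one_sub_pow hp0 hp1 (by linarith)
    have hy : 1 / 2 ≤ (1 - p : ℝ) ^ s (l + 2) := one_half_le_one_sub_pow hp1 h1
    have hxy : (1 - (1 - p : ℝ) ^ s (l + 2)) * (1 - p : ℝ) ^ s (l + 2) ≤ 1 := by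
      have hz : (1 - p : ℝ) ^ s (l + 2) ≤ 1 := pow_le_one₀ (by linarith) (by linarith)
      nlinarith
    refine (Finset.sum_le_card_nsmul _ _ ((1 - p * s (l + 2) / 4 : ℝ) ^ a) fun x hx' => ?_).trans ?_
    · simp only [Finset.mem_offDiag] at hx'
      refine (real_same_code_le p (hB.card (l + 2) le_rfl) (hB.disjoint (l + 2) le_rfl) hx'.2.2
        (hDB _ hx'.1) (hDB _ hx'.2.1)).trans ?_
      rw [Fintype.card_fin]
      refine pow_le_pow_left₀ (by linarith) ?_ a
      nlinarith
    · rw [nsmul_eq_mul]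
      have h4 : (0 : ℝ) ≤ 1 - p * s (l + 2) / 4 := by linarith
      gcongr
      rw [Finset.offDiag_card, sq]
      exact_mod_cast (Nat.sub_le _ _).trans (Nat.mul_le_mul (Finset.card_le_univ _)
        (Finset.card_le_univ _))

/-- The numerical conditions under which the random construction succeeds: `p` is the edge
probability, `n` the number of vertices, `M` the size of the parts, `a` the number of roots, `s k`
the size of the blocks on level `k`, `h k` the number of candidates for each vertex on level
`k + 1`,
and `ε` bounds the probability that a single stage fails. -/
structure TowerBounds (p : ℝ) (n M a l : ℕ) (s h : ℕ → ℕ) (ε : ℝ) : Prop where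
  roots_le : a ≤ M
  size_zero : s 0 = 1
  chunks_le : ∀ k < l + 2, s (k + 1) * h k ≤ M
  size_mono : s l ≤ s (l + 1)
  mul_size_le_one : ∀ k < l + 2, p * s k ≤ 1
  mul_level_le : ∀ k < l + 2, p * (s k * a) ≤ 1 / 2
  mul_pair_le : p * s (l + 1) * (4 * a) ≤ 1
  mul_top_le : p * s (l + 2) ≤ 1 / 2
  level_fail_le : ∀ k < l + 2, a * s (k + 1) * (1 - p * s k / 4) ^ h k ≤ ε
  middle_fail_le : a ^ 2 * (1 - (p * s l) ^ 2 / 8) ^ M ≤ ε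
  separation_fail_le : n ^ 2 * (1 - p * s (l + 2) / 4) ^ a ≤ ε

/-- The tower, the middle vertices and separation are all obtained with high probability. -/
theorem real_tower_le [Fintype V] (p : I) (D : Finset V) {M : ℕ} {h : ℕ → ℕ} {ε : ℝ}
    (hparts : Pairwise fun l l' => Disjoint (parts l) (parts l'))
    (hcard : ∀ k ≤ l + 3, M ≤ (parts k).card) (hD : ∀ k, Disjoint D (parts k))
    (H : TowerBounds p (Fintype.card V) M a l s h ε) :
    (binomialRandom V p).real {G | ∃ B : ℕ → Fin a → Finset V, IsBlockTower G parts s B (l + 2) ∧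
      HasMiddles G parts B l ∧ Separates G (B (l + 2)) D}ᶜ ≤ (l + 4) * ε := by
  classical
  have tower : ∀ k ≤ l + 2, (binomialRandom V p).real
      (⋃ B : ℕ → Fin a → Finset V, {G | IsBlockTower G parts s B k})ᶜ ≤ k * ε := by
    intro k hk
    induction k with
    | zero =>
      have : (⋃ B : ℕ → Fin a → Finset V, {G | IsBlockTower G parts s B 0}) = Set.univ :=
        Set.eq_univ_of_forall fun G => Set.mem_iUnion.2
          (exists_isBlockTower_zero (H.roots_le.trans (hcard 0 (by omega))) H.size_zero G)
      simp [this]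
    | succ k ih =>
      refine (real_isBlockTower_succ_le p hparts ((H.chunks_le k hk).trans (hcard _ (by omega)))
        (H.mul_size_le_one k hk) (H.mul_level_le k hk)).trans ?_
      push_cast
      linarith [ih (by omega), H.level_fail_le k hk]
  have e1 := real_separates_le (a := a) (s := s) (l := l) p D hD H.mul_top_le
  have e2 := real_hasMiddles_le (a := a) (s := s) (l := l) p hparts H.size_mono
    (hcard _ le_rfl) H.mul_pair_le
  have e3 := tower (l + 2) le_rfl
  push_cast at e3
  refine le_trans (le_of_eq ?_) (e1.trans (by linarith [H.middle_fail_le, H.separation_fail_le]))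
  congr 2
  ext G
  simp [and_assoc]

end Tower

/-- There is a path `x, zₗ, …, z₁, b` with `zᵢ ∈ T i`. -/
def Reach (G : SimpleGraph V) (T : ℕ → Set V) : ℕ → V → V → Prop
  | 0, x, b => G.Adj x b
  | l + 1, x, b => ∃ z, z ∈ T (l + 1) ∧ G.Adj x z ∧ Reach G T l z b

/-- The order on the roots that is encoded by the middle vertices `Z`. -/
def RootLT (G : SimpleGraph V) (T : ℕ → Set V) (Z : Set V) (l : ℕ) (b c : V) : Prop :=
  ∃ m, m ∈ Z ∧ Reach G T (l + 1) m b ∧ Reach G T l m c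

/-- The lexicographic comparison of the sets of roots reached from `x` and `y`. -/
def CodeLT (G : SimpleGraph V) (T : ℕ → Set V) (Z : Set V) (l : ℕ) (x y : V) : Prop :=
  ∃ b, b ∈ T 0 ∧ Reach G T (l + 2) y b ∧ ¬ Reach G T (l + 2) x b ∧
    ∀ c, c ∈ T 0 → RootLT G T Z l c b → (Reach G T (l + 2) x c ↔ Reach G T (l + 2) y c)

/-- `y` is an immediate successor of `x` in `D` with respect to `R`. -/
def IsNext (R : V → V → Prop) (D : Set V) (x y : V) : Prop :=
  R x y ∧ ¬ ∃ z, z ∈ D ∧ R x z ∧ R z y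

/-- The relation `R` is a bijection between `D ∩ P` and `D \ P`. -/
def IsPairing (R : V → V → Prop) (D P : Set V) : Prop :=
  (∀ x, x ∈ D ∧ x ∈ P → ∃ y, (y ∈ D ∧ y ∉ P) ∧ R x y ∧ ∀ z, (z ∈ D ∧ z ∉ P) → R x z → z = y) ∧
  (∀ y, y ∈ D ∧ y ∉ P → ∃ x, (x ∈ D ∧ x ∈ P) ∧ R x y ∧ ∀ z, (z ∈ D ∧ z ∈ P) → R z y → z = x)

theorem IsPairing.even_ncard [Finite V] {R : V → V → Prop} {D P : Set V}
    (h : IsPairing R D P) : Even D.ncard := by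
  have h1 : (D ∩ P).ncard = (D \ P).ncard := by
    choose! f hf using h.1
    refine Set.ncard_congr (fun x _ => f x) (fun x hx => (hf x hx).1) ?_ ?_
    · intro x y hx hy hxy
      obtain ⟨u, -, -, hu⟩ := h.2 (f x) (hf x hx).1
      rw [hu x hx (hf x hx).2.1, hu y hy (hxy ▸ (hf y hy).2.1)]
    · intro y hy
      obtain ⟨x, hx, hR, -⟩ := h.2 y hy
      exact ⟨x, hx, ((hf x hx).2.2 y hy hR).symm⟩
  rw [← Set.ncard_inter_add_ncard_sdiff_eq_ncard D P, h1]
  exact ⟨_, rfl⟩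

/-- In a linearly ordered set of even size, the elements can be paired up consecutively. -/
theorem exists_isPairing {L : Type*} [LinearOrder L] (f : V → L) (D : Finset V)
    (hf : Set.InjOn f D) (hD : Even D.card) {R : V → V → Prop}
    (hR : ∀ x ∈ D, ∀ y ∈ D, R x y ↔ f x < f y) :
    ∃ P : Set V, IsPairing (IsNext R D) D P := by
  classical
  obtain ⟨c, hc⟩ := hD
  have hcard : (D.image f).card = c + c := by rw [Finset.card_image_of_injOn hf, hc]
  let e := (D.image f).orderIsoOfFin hcard
  have he : ∀ i, ∃ x ∈ D, f x = e i := fun i => Finset.mem_image.1 (e i).2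
  choose g hgD hg using he
  have hlt : ∀ i k, R (g i) (g k) ↔ (i : ℕ) < k := fun i k => by
    rw [hR _ (hgD i) _ (hgD k), hg, hg, Subtype.coe_lt_coe, e.lt_iff_lt, Fin.lt_def]
  have hinj : Function.Injective g := fun i k hik => by
    have : (e i : L) = e k := by rw [← hg, ← hg, hik]
    exact e.injective (Subtype.ext this)
  have hsurj : ∀ x ∈ D, ∃ i, g i = x := fun x hx => by
    refine ⟨e.symm ⟨f x, Finset.mem_image_of_mem f hx⟩, hf (hgD _) hx ?_⟩
    rw [hg, OrderIso.apply_symm_apply]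
  have hnext : ∀ i k, IsNext R D (g i) (g k) ↔ (k : ℕ) = i + 1 := by
    intro i k
    simp only [IsNext, hlt]
    constructor
    · rintro ⟨h1, h2⟩
      by_contra h3
      refine h2 ⟨g ⟨i + 1, by omega⟩, hgD _, ?_, ?_⟩ <;> rw [hlt] <;> simp only <;> omega
    · intro h1
      refine ⟨by omega, ?_⟩
      rintro ⟨z, hz, h2, h3⟩
      obtain ⟨m, rfl⟩ := hsurj z hz
      rw [hlt] at h2 h3
      omega
  have hP : ∀ i, g i ∈ g '' {i | Even (i : ℕ)} ↔ Even (i : ℕ) := fun i => by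
    rw [hinj.mem_set_image]; rfl
  refine ⟨g '' {i | Even (i : ℕ)}, ?_, ?_⟩
  · rintro x ⟨hx, hxP⟩
    obtain ⟨i, rfl⟩ := hsurj x hx
    obtain ⟨r, hr⟩ := (hP i).1 hxP
    have hi : (i : ℕ) + 1 < c + c := by omega
    refine ⟨g ⟨i + 1, hi⟩, ⟨hgD _, ?_⟩, (hnext _ _).2 rfl, ?_⟩
    · rw [hP]; simp only [Nat.even_add_one, not_not]; exact ⟨r, hr⟩
    · rintro z ⟨hz, -⟩ h1
      obtain ⟨k, rfl⟩ := hsurj z hz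
      rw [hnext] at h1
      congr 1
      exact Fin.ext h1
  · rintro y ⟨hy, hyP⟩
    obtain ⟨i, rfl⟩ := hsurj y hy
    rw [hP, Nat.not_even_iff_odd] at hyP
    obtain ⟨r, hr⟩ := hyP
    refine ⟨g ⟨i - 1, by omega⟩, ⟨hgD _, ?_⟩, (hnext _ _).2 (by simp only; omega), ?_⟩
    · rw [hP]; exact ⟨r, by simp only; omega⟩
    · rintro z ⟨hz, -⟩ h1
      obtain ⟨k, rfl⟩ := hsurj z hz
      rw [hnext] at h1
      congr 1
      exact Fin.ext (by simp only; omega)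

section Completeness

variable {a : ℕ} {parts : ℕ → Finset V} {s : ℕ → ℕ} {l : ℕ}

theorem IsBlockTower.reach_iff {G : SimpleGraph V} {B : ℕ → Fin a → Finset V}
    (hB : IsBlockTower G parts s B l) {b : Fin a → V} (hb : ∀ i, B 0 i = {b i}) {k : ℕ}
    (hk : k ≤ l) (x : V) (i : Fin a) :
    Reach G (fun k => ⋃ i, (B k i : Set V)) k x (b i) ↔ HasNbr G x (B k i) := by
  induction k generalizing x with
  | zero => simp [Reach, HasNbr, hb]
  | succ k ih =>
    simp only [Reach, HasNbr, ih (by omega), Set.mem_iUnion, Finset.mem_coe]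
    constructor
    · rintro ⟨z, ⟨i', hz⟩, hxz, hzb⟩
      have := (hB.code k hk i' z hz i).1 hzb
      rw [Finset.mem_singleton] at this
      exact ⟨z, this ▸ hz, hxz⟩
    · rintro ⟨z, hz, hxz⟩
      exact ⟨z, ⟨i, hz⟩, hxz, (hB.code k hk i z hz i).2 (by simp)⟩

/-- The tower, the middle vertices and separation make `D` linearly ordered by a definable
relation, hence allow a definable pairing if the size of `D` is even. -/
theorem exists_isPairing_codeLT {G : SimpleGraph V} {B : ℕ → Fin a → Finset V} {D : Finset V}
    (hs : s 0 = 1) (hB : IsBlockTower G parts s B (l + 2)) (hM : HasMiddles G parts B l)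
    (hS : Separates G (B (l + 2)) D) (hD : Even D.card) :
    ∃ (T : ℕ → Set V) (Z P : Set V), IsPairing (IsNext (CodeLT G T Z l) D) D P := by
  have hb : ∀ i, ∃ b, B 0 i = {b} := fun i =>
    Finset.card_eq_one.1 ((hB.card 0 (by omega) i).trans hs)
  choose b hb using hb
  choose m hm hcode using hM
  have hT0 : ∀ x, x ∈ (⋃ i, (B 0 i : Set V)) ↔ ∃ i, b i = x := by
    intro x; simp [hb, eq_comm]
  set T : ℕ → Set V := fun k => ⋃ i, (B k i : Set V) with hT
  have hreach : ∀ k ≤ l + 2, ∀ x i, Reach G T k x (b i) ↔ HasNbr G x (B k i) :=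
    fun k hk => hB.reach_iff hb hk
  have hroot : ∀ i k, RootLT G T {x | ∃ i k, i < k ∧ m i k = x} l (b i) (b k) ↔ i < k := by
    intro i k
    have h1 : ∀ i' k', HasNbr G (m i' k') (B (l + 1) i) ↔ i = i' := fun i' k' => by
      simpa [blockPair] using hcode i' k' (i, true)
    have h2 : ∀ i' k', HasNbr G (m i' k') (B l k) ↔ k = k' := fun i' k' => by
      simpa [blockPair] using hcode i' k' (k, false)
    simp only [RootLT, hreach _ (show l + 1 ≤ l + 2 by omega), hreach _ (show l ≤ l + 2 by omega)]
    constructor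
    · rintro ⟨_, ⟨i', k', hik, rfl⟩, h3, h4⟩
      rw [h1] at h3
      rw [h2] at h4
      rwa [h3, h4]
    · intro hik
      exact ⟨_, ⟨i, k, hik, rfl⟩, (h1 _ _).2 rfl, (h2 _ _).2 rfl⟩
  refine ⟨T, {x | ∃ i k, i < k ∧ m i k = x}, exists_isPairing
    (fun x => toLex fun i => HasNbr G x (B (l + 2) i)) D ?_ hD ?_⟩
  · intro x hx y hy hxy
    by_contra hne
    exact hS x hx y hy hne fun i => iff_of_eq (congrFun (toLex_inj.1 hxy) i)
  · intro x _ y _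
    constructor
    · rintro ⟨_, h0, h1, h2, h3⟩
      obtain ⟨i, rfl⟩ := (hT0 _).1 h0
      rw [hreach _ le_rfl] at h1 h2
      refine ⟨i, fun k hk => ?_, ?_⟩
      · have := h3 (b k) ((hT0 _).2 ⟨k, rfl⟩) ((hroot k i).2 hk)
        rw [hreach _ le_rfl, hreach _ le_rfl] at this
        exact propext this
      · exact lt_of_le_not_ge (fun h => absurd h h2) (fun h => h2 (h h1))
    · rintro ⟨i, h1, h2⟩
      obtain ⟨h3, h4⟩ := lt_iff_le_not_ge.1 h2
      obtain ⟨h5, h6⟩ := Classical.not_imp.1 h4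
      refine ⟨b i, (hT0 _).2 ⟨i, rfl⟩, (hreach _ le_rfl _ _).2 h5,
        fun h => h6 ((hreach _ le_rfl _ _).1 h), fun c hc hlt => ?_⟩
      obtain ⟨k, rfl⟩ := (hT0 _).1 hc
      rw [hreach _ le_rfl, hreach _ le_rfl]
      exact iff_of_eq (h1 k ((hroot k i).1 hlt))
end Completeness

end RandomGraph

section Definability

open FirstOrder.Language

/-- The family of sets interpreting the unary symbols, indexed by all natural numbers. -/
def extendSets {n m : ℕ} (S : Fin m → Set (Fin n)) (c : ℕ) : Set (Fin n) :=
  if h : c < m then S ⟨c, h⟩ else ∅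

/-- A property of a graph, unary predicates and `k` vertices. -/
abbrev VertexProp (m k : ℕ) : Type :=
  ∀ n : ℕ, SimpleGraph (Fin n) → (Fin m → Set (Fin n)) → (Fin k → Fin n) → Prop

/-- The property is defined by a first-order formula. -/
def IsFO {m k : ℕ} (Q : VertexProp m k) : Prop :=
  ∃ φ : (Lang m).BoundedFormula Empty k, ∀ n G S v,
    @BoundedFormula.Realize (Lang m) (Fin n) (structOf G S) Empty k φ default v ↔ Q n G S v

variable {m k : ℕ} {Q Q' : VertexProp m k}

theorem isFO_adj (i j : Fin k) : IsFO (m := m) fun _ G _ v => G.Adj (v i) (v j) :=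
  ⟨BoundedFormula.rel (l := 2) (show (Lang m).Relations 2 from ()) ![&i, &j],
    fun _ _ _ _ => Iff.rfl⟩

theorem isFO_eq (i j : Fin k) : IsFO (m := m) fun _ _ _ v => v i = v j :=
  ⟨(&i).bdEqual &j, fun _ _ _ _ => Iff.rfl⟩

theorem isFO_mem (c : ℕ) (i : Fin k) : IsFO (m := m) fun _ _ S v => v i ∈ extendSets S c := by
  by_cases h : c < m
  · refine ⟨BoundedFormula.rel (l := 1) (show (Lang m).Relations 1 from (⟨c, h⟩ : Fin m)) ![&i],
      fun n G S v => ?_⟩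
    simp only [extendSets, dif_pos h]
    exact Iff.rfl
  · refine ⟨⊥, fun n G S v => ?_⟩
    simp only [extendSets, dif_neg h]
    exact Iff.rfl

theorem IsFO.imp (h : IsFO Q) (h' : IsFO Q') : IsFO fun n G S v => Q n G S v → Q' n G S v := by
  obtain ⟨φ, hφ⟩ := h
  obtain ⟨ψ, hψ⟩ := h'
  exact ⟨φ.imp ψ, fun n G S v => imp_congr (hφ n G S v) (hψ n G S v)⟩

theorem IsFO.not (h : IsFO Q) : IsFO fun n G S v => ¬ Q n G S v := by
  obtain ⟨φ, hφ⟩ := h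
  exact ⟨φ.not, fun n G S v => not_congr (hφ n G S v)⟩

theorem IsFO.congr (h : IsFO Q) (hQ : ∀ n G S v, Q n G S v ↔ Q' n G S v) : IsFO Q' := by
  obtain ⟨φ, hφ⟩ := h
  exact ⟨φ, fun n G S v => (hφ n G S v).trans (hQ n G S v)⟩

theorem IsFO.and (h : IsFO Q) (h' : IsFO Q') : IsFO fun n G S v => Q n G S v ∧ Q' n G S v :=
  (h.imp h'.not).not.congr fun _ _ _ _ => by tauto

theorem IsFO.iff (h : IsFO Q) (h' : IsFO Q') : IsFO fun n G S v => (Q n G S v ↔ Q' n G S v) :=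
  ((h.imp h').and (h'.imp h)).congr fun _ _ _ _ => by tauto

theorem IsFO.all {Q : VertexProp m (k + 1)} (h : IsFO Q) :
    IsFO fun n G S v => ∀ x, Q n G S (Fin.snoc v x) := by
  obtain ⟨φ, hφ⟩ := h
  exact ⟨φ.all, fun n G S v => forall_congr' fun x => hφ n G S (Fin.snoc v x)⟩

theorem IsFO.ex {Q : VertexProp m (k + 1)} (h : IsFO Q) :
    IsFO fun n G S v => ∃ x, Q n G S (Fin.snoc v x) :=
  h.not.all.not.congr fun _ _ _ _ => by simp

/-- A binary relation on the vertices. -/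
abbrev VertexRel (m : ℕ) : Type :=
  ∀ n : ℕ, SimpleGraph (Fin n) → (Fin m → Set (Fin n)) → Fin n → Fin n → Prop

/-- The binary relation is first-order definable. -/
def IsFORel (R : VertexRel m) : Prop :=
  ∀ ⦃k : ℕ⦄ (i j : Fin k), IsFO fun n G S v => R n G S (v i) (v j)

theorem isFORel_reach (c l : ℕ) :
    IsFORel (m := m) fun _ G S => Reach G (fun t => extendSets S (c + t)) l := by
  induction l with
  | zero => exact fun k i j => isFO_adj i j
  | succ l ih =>
    exact fun k i j => ((isFO_mem (c + (l + 1)) (Fin.last k)).and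
      ((isFO_adj i.castSucc (Fin.last k)).and (ih (Fin.last k) j.castSucc))).ex.congr
        fun _ _ _ _ => by simp [Reach]

theorem isFORel_rootLT (c d l : ℕ) : IsFORel (m := m) fun _ G S =>
    RootLT G (fun t => extendSets S (c + t)) (extendSets S d) l :=
  fun k i j => ((isFO_mem d (Fin.last k)).and
    ((isFORel_reach c (l + 1) (Fin.last k) i.castSucc).and
      (isFORel_reach c l (Fin.last k) j.castSucc))).ex.congr fun _ _ _ _ => by simp [RootLT]

theorem isFORel_codeLT (c d l : ℕ) : IsFORel (m := m) fun _ G S =>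
    CodeLT G (fun t => extendSets S (c + t)) (extendSets S d) l :=
  fun k i j => ((isFO_mem c (Fin.last k)).and <|
    (isFORel_reach c (l + 2) j.castSucc (Fin.last k)).and <|
    (isFORel_reach c (l + 2) i.castSucc (Fin.last k)).not.and <|
    IsFO.all <| (isFO_mem c (Fin.last (k + 1))).imp <|
    (isFORel_rootLT c d l (Fin.last (k + 1)) (Fin.last k).castSucc).imp <|
    (isFORel_reach c (l + 2) i.castSucc.castSucc (Fin.last (k + 1))).iff
      (isFORel_reach c (l + 2) j.castSucc.castSucc (Fin.last (k + 1)))).ex.congr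
        fun _ _ _ _ => by simp [CodeLT]

theorem IsFORel.isNext {R : VertexRel m} (hR : IsFORel R) (d : ℕ) :
    IsFORel fun n G S => IsNext (R n G S) (extendSets S d) :=
  fun k i j => ((hR i j).and <| IsFO.not <| IsFO.ex <| (isFO_mem d (Fin.last k)).and <|
    (hR i.castSucc (Fin.last k)).and (hR (Fin.last k) j.castSucc)).congr
      fun _ _ _ _ => by simp [IsNext]

theorem IsFORel.isPairing {R : VertexRel m} (hR : IsFORel R) (d e : ℕ) :
    IsFO (k := k) fun n G S _ => IsPairing (R n G S) (extendSets S d) (extendSets S e) := by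
  have hin : ∀ ⦃k : ℕ⦄ (i : Fin k), IsFO (m := m) fun _ _ S v =>
      v i ∈ extendSets S d ∧ v i ∈ extendSets S e := fun k i => (isFO_mem d i).and (isFO_mem e i)
  have hout : ∀ ⦃k : ℕ⦄ (i : Fin k), IsFO (m := m) fun _ _ S v =>
      v i ∈ extendSets S d ∧ v i ∉ extendSets S e :=
    fun k i => (isFO_mem d i).and (isFO_mem e i).not
  exact (((hin (Fin.last k)).imp <| IsFO.ex <| (hout (Fin.last (k + 1))).and <|
      (hR (Fin.last k).castSucc (Fin.last (k + 1))).and <| IsFO.all <|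
      (hout (Fin.last (k + 2))).imp <|
      (hR (Fin.last k).castSucc.castSucc (Fin.last (k + 2))).imp <|
      isFO_eq (Fin.last (k + 2)) (Fin.last (k + 1)).castSucc).all.and
    ((hout (Fin.last k)).imp <| IsFO.ex <| (hin (Fin.last (k + 1))).and <|
      (hR (Fin.last (k + 1)) (Fin.last k).castSucc).and <| IsFO.all <|
      (hin (Fin.last (k + 2))).imp <|
      (hR (Fin.last (k + 2)) (Fin.last k).castSucc.castSucc).imp <|
      isFO_eq (Fin.last (k + 2)) (Fin.last (k + 1)).castSucc).all).congr
        fun _ _ _ _ => by simp [IsPairing]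

/-- The two sets with indices `d` and `d'` are complementary, and each is perfectly paired up. -/
def IsEvenWitness (l : ℕ) {n : ℕ} (G : SimpleGraph (Fin n))
    (S : Fin (2 * (l + 6)) → Set (Fin n)) : Prop :=
  (∀ x, x ∈ extendSets S 4 ↔ x ∉ extendSets S 5) ∧
  IsPairing (IsNext (CodeLT G (fun t => extendSets S (6 + t)) (extendSets S 0) l)
    (extendSets S 4)) (extendSets S 4) (extendSets S 2) ∧
  IsPairing (IsNext (CodeLT G (fun t => extendSets S (9 + l + t)) (extendSets S 1) l)
    (extendSets S 5)) (extendSets S 5) (extendSets S 3)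

theorem exists_sentence (l : ℕ) : ∃ φ : (Lang (2 * (l + 6))).Sentence,
    ∀ (n : ℕ) (G : SimpleGraph (Fin n)), EMSOSat G φ ↔ ∃ S, IsEvenWitness l G S := by
  obtain ⟨φ, hφ⟩ : IsFO (k := 0) fun n G S _ => IsEvenWitness l (n := n) G S :=
    (((isFO_mem 4 (Fin.last 0)).iff (isFO_mem 5 (Fin.last 0)).not).all.and
      ((((isFORel_codeLT 6 0 l).isNext 4).isPairing 4 2).and
        (((isFORel_codeLT (9 + l) 1 l).isNext 5).isPairing 5 3))).congr
      fun _ _ _ _ => by simp only [Fin.snoc_last]; exact Iff.rfl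
  refine ⟨φ, fun n G => exists_congr fun S => ?_⟩
  exact hφ n G S default

theorem IsEvenWitness.even {l n : ℕ} {G : SimpleGraph (Fin n)}
    {S : Fin (2 * (l + 6)) → Set (Fin n)} (h : IsEvenWitness l G S) : Even n := by
  have h1 : extendSets S 4 = (extendSets S 5)ᶜ := Set.ext h.1
  have h2 := Set.ncard_add_ncard_compl (extendSets S 5)
  rw [← h1, Nat.card_fin] at h2
  exact h2 ▸ h.2.2.even_ncard.add h.2.1.even_ncard

end Definability

section Congr

variable {V : Type*}

theorem Reach.congr {G : SimpleGraph V} {T T' : ℕ → Set V} {k : ℕ} (h : ∀ t ≤ k, T t = T' t) :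
    Reach G T k = Reach G T' k := by
  induction k with
  | zero => rfl
  | succ k ih =>
    funext x b
    rw [Reach, Reach, h _ le_rfl, ih fun t ht => h t (by omega)]

theorem CodeLT.congr {G : SimpleGraph V} {T T' : ℕ → Set V} {Z : Set V} {l : ℕ}
    (h : ∀ t ≤ l + 2, T t = T' t) : CodeLT G T Z l = CodeLT G T' Z l := by
  funext x y
  simp only [CodeLT, RootLT, h 0 (by omega), Reach.congr (G := G) h,
    Reach.congr (G := G) (k := l + 1) fun t ht => h t (by omega),
    Reach.congr (G := G) (k := l) fun t ht => h t (by omega)]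

end Congr

/-- Definable pairings of a set and of its complement combine to a witness for evenness. -/
theorem exists_isEvenWitness {l n : ℕ} {G : SimpleGraph (Fin n)} {D D' : Set (Fin n)}
    (hD : D' = Dᶜ)
    (h : ∃ (T : ℕ → Set (Fin n)) (Z P : Set (Fin n)), IsPairing (IsNext (CodeLT G T Z l) D) D P)
    (h' : ∃ (T : ℕ → Set (Fin n)) (Z P : Set (Fin n)),
      IsPairing (IsNext (CodeLT G T Z l) D') D' P) :
    ∃ S, IsEvenWitness l G S := by
  obtain ⟨T, Z, P, h⟩ := h
  obtain ⟨T', Z', P', h'⟩ := h'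
  let g : ℕ → Set (Fin n) := fun c => if c = 0 then Z else if c = 1 then Z' else
    if c = 2 then P else if c = 3 then P' else if c = 4 then D else if c = 5 then D' else
    if c < 9 + l then T (c - 6) else T' (c - (9 + l))
  have hg : ∀ c < 2 * (l + 6), extendSets (fun i : Fin (2 * (l + 6)) => g i) c = g c :=
    fun c hc => by simp only [extendSets, dif_pos hc]
  refine ⟨fun i => g i, ?_, ?_, ?_⟩
  · rw [hg 4 (by omega), hg 5 (by omega)]
    simp [g, hD]
  · rw [hg 0 (by omega), hg 2 (by omega), hg 4 (by omega), CodeLT.congr (T' := T)]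
    · exact h
    · intro t ht
      rw [hg _ (by omega)]
      simp only [g]
      rw [if_neg (by omega), if_neg (by omega), if_neg (by omega), if_neg (by omega),
        if_neg (by omega), if_neg (by omega), if_pos (by omega), Nat.add_sub_cancel_left]
  · rw [hg 1 (by omega), hg 3 (by omega), hg 5 (by omega), CodeLT.congr (T' := T')]
    · exact h'
    · intro t ht
      rw [hg _ (by omega)]
      simp only [g]
      rw [if_neg (by omega), if_neg (by omega), if_neg (by omega), if_neg (by omega),
        if_neg (by omega), if_neg (by omega), if_neg (by omega), Nat.add_sub_cancel_left]

section Asymptotic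

open Asymptotics

theorem eventually_pow_mul_exp_neg_le {c C ε : ℝ} (hc : 0 < c) (hC : 0 < C) (hε : 0 < ε) (N : ℕ) :
    ∀ᶠ t : ℕ in atTop, C * (t : ℝ) ^ N * Real.exp (-(c * t)) ≤ ε := by
  have h := ((isLittleO_pow_exp_pos_mul_atTop N hc).comp_tendsto
    tendsto_natCast_atTop_atTop).def (div_pos hε hC)
  filter_upwards [h] with t ht
  simp only [Function.comp_apply, Real.norm_eq_abs, Real.abs_exp,
    abs_of_nonneg (pow_nonneg (Nat.cast_nonneg (α := ℝ) t) N)] at ht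
  calc C * (t : ℝ) ^ N * Real.exp (-(c * t))
      ≤ C * (ε / C * Real.exp (c * t)) * Real.exp (-(c * t)) := by gcongr
    _ = ε := by
      rw [mul_assoc, mul_assoc, ← Real.exp_add]
      simp [field]

/-- The conditions hold for blocks of size `t ^ (2 * k)` and edge probability of order
`t ^ (-(2 * l + 6))`, if `t` is large. -/
theorem eventually_towerBounds {l : ℕ} (hl : 3 ≤ l) {C : ℝ} (hC : 1 ≤ C) (K : ℕ) {ε : ℝ}
    (hε : 0 < ε) : ∀ᶠ t : ℕ in atTop, ∀ (p : ℝ) (H n : ℕ), 0 ≤ p → p * t ^ (2 * l + 6) ≤ 1 →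
      1 ≤ C * (p * t ^ (2 * l + 6)) → t ^ 6 ≤ H → (n : ℝ) ≤ C * t ^ K →
      TowerBounds p n (t ^ (2 * l + 4) * H) (t ^ 3) l (fun k => t ^ (2 * k))
        (fun k => t ^ (2 * (l + 1 - k)) * H) ε := by
  have hc : (0 : ℝ) < 1 / (8 * C ^ 2) := by positivity
  filter_upwards [eventually_pow_mul_exp_neg_le hc (show 0 < C ^ 2 by positivity) hε
    (2 * l + 7 + 6 + K * 2), eventually_ge_atTop 4] with t htε ht4 p H n hp hp1 hp2 hH hn
  have ht : (4 : ℝ) ≤ t := by exact_mod_cast ht4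
  have ht1 : (1 : ℝ) ≤ t := by linarith
  have hH' : (t : ℝ) ^ 6 ≤ H := by exact_mod_cast hH
  have hfin : ∀ {A x : ℝ} {N : ℕ}, 0 ≤ A → A ≤ C ^ 2 * (t : ℝ) ^ (2 * l + 7 + 6 + K * 2) → x ≤ 1 →
      1 / (8 * C ^ 2) * t ≤ x * N → A * (1 - x) ^ N ≤ ε := by
    intro A x N hA0 hA hx hN
    refine le_trans ?_ htε
    refine mul_le_mul hA ((one_sub_pow_le_exp hx N).trans ?_)
      (pow_nonneg (by linarith) _) (by positivity)
    gcongr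
  have hpow : ∀ {i j : ℕ}, i ≤ j → (t : ℝ) ^ i ≤ t ^ j := fun h => pow_le_pow_right₀ ht1 h
  have hpow' : ∀ {i j : ℕ}, i ≤ j → t ^ i ≤ t ^ j := fun h => Nat.pow_le_pow_right (by omega) h
  have hmul : ∀ {i : ℕ}, i ≤ 2 * l + 6 → p * (t : ℝ) ^ i ≤ 1 := fun h =>
    (mul_le_mul_of_nonneg_left (hpow h) hp).trans hp1
  have hmul4 : ∀ {i : ℕ}, i ≤ 2 * l + 5 → 4 * (p * (t : ℝ) ^ i) ≤ 1 := fun {i} h => by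
    have h1 : p * (t : ℝ) ^ (i + 1) ≤ 1 := hmul (by omega)
    have h2 : 0 ≤ p * (t : ℝ) ^ i := by positivity
    rw [pow_succ] at h1
    nlinarith
  have hpos : ∀ {i : ℕ}, 0 ≤ p * (t : ℝ) ^ i := by intro i; positivity
  have hC2 : 1 ≤ C ^ 2 := one_le_pow₀ hC
  have hinv : 1 / C ≤ p * t ^ (2 * l + 6) := by
    rwa [div_le_iff₀ (by linarith), mul_comm]
  have hcC : 1 / (8 * C ^ 2) ≤ 1 / C / 4 := by
    rw [div_div]
    exact one_div_le_one_div_of_le (by positivity) (by nlinarith)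
  refine ⟨?_, by simp, fun k hk => ?_, hpow' (by omega), fun k hk => ?_, fun k hk => ?_, ?_, ?_,
    fun k hk => ?_, ?_, ?_⟩
  · calc t ^ 3 ≤ t ^ 6 := hpow' (by omega)
      _ ≤ 1 * H := by simpa using hH
      _ ≤ t ^ (2 * l + 4) * H := by
        gcongr
        exact Nat.one_le_pow _ _ (by omega)
  · rw [← mul_assoc, ← pow_add, show 2 * (k + 1) + 2 * (l + 1 - k) = 2 * l + 4 by omega]
  · push_cast
    exact hmul (by omega)
  · push_cast
    rw [← pow_add]
    linarith [hmul4 (show 2 * k + 3 ≤ 2 * l + 5 by omega)]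
  · push_cast
    have := hmul4 (show 2 * (l + 1) + 3 ≤ 2 * l + 5 by omega)
    rw [pow_add] at this
    linarith
  · push_cast
    linarith [hmul4 (show 2 * (l + 2) ≤ 2 * l + 5 by omega)]
  · push_cast
    refine hfin (by positivity) ?_ ?_ ?_
    · rw [← pow_add]
      calc (t : ℝ) ^ (3 + 2 * (k + 1)) ≤ t ^ (2 * l + 7 + 6 + K * 2) := hpow (by omega)
        _ ≤ _ := le_mul_of_one_le_left (by positivity) hC2
    · linarith [hmul (show 2 * k ≤ 2 * l + 6 by omega)]
    · push_cast
      calc 1 / (8 * C ^ 2) * (t : ℝ) ≤ 1 / C / 4 * t := by gcongr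
        _ ≤ p * t ^ (2 * l + 6) / 4 * t := by gcongr
        _ ≤ p * t ^ (2 * l + 6) / 4 * t ^ 2 := by gcongr; nlinarith
        _ = p * t ^ (2 * l + 2) / 4 * t ^ 6 := by ring
        _ ≤ p * t ^ (2 * l + 2) / 4 * H := by gcongr
        _ = p * t ^ (2 * k) / 4 * (t ^ (2 * (l + 1 - k)) * H) := by
          rw [show 2 * l + 2 = 2 * k + 2 * (l + 1 - k) by omega, pow_add]; ring
  · push_cast
    refine hfin (by positivity) ?_ ?_ ?_
    · rw [← pow_mul]
      calc (t : ℝ) ^ (3 * 2) ≤ t ^ (2 * l + 7 + 6 + K * 2) := hpow (by omega)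
        _ ≤ _ := le_mul_of_one_le_left (by positivity) hC2
    · have := pow_le_one₀ (n := 2) (hpos (i := 2 * l)) (hmul (by omega))
      linarith
    · push_cast
      calc 1 / (8 * C ^ 2) * (t : ℝ) = (1 / C) ^ 2 / 8 * t := by
            field_simp
        _ ≤ (p * t ^ (2 * l + 6)) ^ 2 / 8 * t := by gcongr
        _ = (p * t ^ (2 * l)) ^ 2 / 8 * (t ^ 7 * t ^ 6) := by ring
        _ ≤ (p * t ^ (2 * l)) ^ 2 / 8 * (t ^ (2 * l + 4) * H) := by
          gcongr
          omega
  · push_cast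
    refine hfin (by positivity) ?_ ?_ ?_
    · calc (n : ℝ) ^ 2 ≤ (C * t ^ K) ^ 2 := by gcongr
        _ = C ^ 2 * t ^ (K * 2) := by rw [mul_pow, pow_mul]
        _ ≤ _ := by
          gcongr
          omega
    · linarith [hmul (show 2 * (l + 2) ≤ 2 * l + 6 by omega)]
    · push_cast
      calc 1 / (8 * C ^ 2) * (t : ℝ) ≤ 1 / C / 4 * t := by gcongr
        _ ≤ p * t ^ (2 * l + 6) / 4 * t := by gcongr
        _ = p * t ^ (2 * (l + 2)) / 4 * t ^ 3 := by ring

end Asymptotic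

section Likely

open MeasureTheory ProbabilityTheory unitInterval SimpleGraph

theorem card_filter_div_eq {n M c : ℕ} (hM : 0 < M) (h : (c + 1) * M ≤ n) :
    (Finset.univ.filter fun v : Fin n => (v : ℕ) / M = c).card = M := by
  have : (Finset.univ.filter fun v : Fin n => (v : ℕ) / M = c) =
      (Finset.Ico (c * M) ((c + 1) * M)).attachFin fun v hv => by
        have := (Finset.mem_Ico.1 hv).2; omega := by
    ext v
    simp only [Finset.mem_filter, Finset.mem_univ, true_and, Nat.div_eq_iff hM,
      Finset.mem_attachFin, Finset.mem_Ico, Nat.succ_mul]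
    omega
  rw [this, Finset.card_attachFin, Nat.card_Ico, Nat.succ_mul, Nat.add_sub_cancel_left]

theorem card_filter_div_lt {n M c : ℕ} (h : c * M ≤ n) (hM : 0 < M) :
    (Finset.univ.filter fun v : Fin n => (v : ℕ) / M < c).card = c * M := by
  have : (Finset.univ.filter fun v : Fin n => (v : ℕ) / M < c) =
      (Finset.range (c * M)).attachFin fun v hv => by
        have := Finset.mem_range.1 hv; omega := by
    ext v
    simp [Nat.div_lt_iff_lt_mul hM]
  rw [this, Finset.card_attachFin, Finset.card_range]

/-- A set of even size is pairable with high probability, if there is room for a tower elsewhere. -/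
theorem real_exists_isPairing_le {n M a l o : ℕ} {s h : ℕ → ℕ} {ε : ℝ} (p : I) (hM : 0 < M)
    (H : TowerBounds p n M a l s h ε) (ho : (o + (l + 4)) * M ≤ n) (D : Finset (Fin n))
    (hD : ∀ v ∈ D, (v : ℕ) / M < o ∨ o + (l + 4) ≤ (v : ℕ) / M) (hD2 : Even D.card) :
    (binomialRandom (Fin n) p).real {G | ∃ (T : ℕ → Set (Fin n)) (Z P : Set (Fin n)),
      IsPairing (IsNext (CodeLT G T Z l) D) D P}ᶜ ≤ (l + 4) * ε := by
  let parts : ℕ → Finset (Fin n) := fun k =>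
    Finset.univ.filter fun v => (v : ℕ) / M = o + k ∧ k < l + 4
  have hmem : ∀ k v, v ∈ parts k ↔ (v : ℕ) / M = o + k ∧ k < l + 4 := by simp [parts]
  refine le_trans (measureReal_mono ?_) (real_tower_le (parts := parts) p D ?_ ?_ ?_
    ((Fintype.card_fin n).symm ▸ H))
  · refine Set.compl_subset_compl.2 ?_
    rintro G ⟨B, hB, hB', hB''⟩
    exact exists_isPairing_codeLT H.size_zero hB hB' hB'' hD2
  · refine fun k k' hk => Finset.disjoint_left.2 fun v hv hv' => ?_
    rw [hmem] at hv hv'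
    omega
  · intro k hk
    have : parts k = Finset.univ.filter fun v : Fin n => (v : ℕ) / M = o + k := by
      ext v; simp [hmem]; omega
    rw [this, card_filter_div_eq hM]
    exact (Nat.mul_le_mul_right M (by omega)).trans ho
  · refine fun k => Finset.disjoint_left.2 fun v hv hv' => ?_
    have := hD v hv
    rw [hmem] at hv'
    omega

theorem half_le_real_isEvenWitness {n M a l : ℕ} {s h : ℕ → ℕ} (p : I) (hM : 0 < M)
    (H : TowerBounds p n M a l s h (1 / (4 * (l + 4)))) (hn : n = 2 * (l + 4) * M)
    (hM2 : Even M) :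
    1 / 2 ≤ (binomialRandom (Fin n) p).real {G | ∃ S, IsEvenWitness l G S} := by
  have hbound : ((l : ℝ) + 4) * (1 / (4 * (l + 4))) = 1 / 4 := by
    have : (l : ℝ) + 4 ≠ 0 := by positivity
    field_simp
  have hn' : (l + 4) * M + (l + 4) * M = n := by rw [hn]; ring
  let D : Finset (Fin n) := Finset.univ.filter fun v => (v : ℕ) / M < l + 4
  have hDcard : D.card = (l + 4) * M := card_filter_div_lt (by omega) hM
  have h0 := real_exists_isPairing_le (o := l + 4) p hM H (by rw [hn]; ring_nf; rfl) D
    (fun v hv => .inl (by simpa [D] using hv)) (hDcard ▸ hM2.mul_left _)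
  have h1 := real_exists_isPairing_le (o := 0) p hM H (by rw [zero_add]; omega) Dᶜ
    (fun v hv => .inr (by simpa [D] using hv)) (by
      rw [Finset.card_compl, hDcard, Fintype.card_fin, ← hn', Nat.add_sub_cancel]
      exact hM2.mul_left _)
  rw [hbound] at h0 h1
  have h2 : {G : SimpleGraph (Fin n) | ∃ S, IsEvenWitness l G S}ᶜ ⊆
      {G | ∃ T Z P, IsPairing (IsNext (CodeLT G T Z l) D) D P}ᶜ ∪
      {G | ∃ T Z P, IsPairing (IsNext (CodeLT G T Z l) (Dᶜ : Finset (Fin n)))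
        (Dᶜ : Finset (Fin n)) P}ᶜ := by
    rw [← Set.compl_inter, Set.compl_subset_compl]
    rintro G ⟨h, h'⟩
    exact exists_isEvenWitness (D := D) (D' := (Dᶜ : Finset (Fin n))) (by simp) h h'
  have h3 := (measureReal_mono (μ := binomialRandom (Fin n) p) h2).trans
    (measureReal_union_le _ _)
  rw [probReal_compl_eq_one_sub (measurableSet_simpleGraph _)] at h3
  linarith

/-- Sizes of the vertex set and of the parts for which towers are likely to exist at edge
density `n ^ (-α)`. -/
theorem exists_size {α : ℝ} (hα0 : 0 < α) (hα1 : α < 1) {l : ℕ}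
    (hl : 4 ≤ (2 * l + 6) * (1 / α - 1)) {t : ℕ} (ht : 1 ≤ t) :
    ∃ H n : ℕ, n = 2 * (l + 4) * (t ^ (2 * l + 4) * H) ∧ Even H ∧ t ^ 6 ≤ H ∧
      (n : ℝ) ^ (-α) * t ^ (2 * l + 6) ≤ 1 ∧
      1 ≤ (8 * (l + 4) : ℝ) * ((n : ℝ) ^ (-α) * t ^ (2 * l + 6)) ∧
      (n : ℝ) ≤ 8 * (l + 4) * (t : ℝ) ^ ⌈(2 * l + 6) / α⌉₊ := by
  have ht' : (1 : ℝ) ≤ t := by exact_mod_cast ht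
  have ht0 : (0 : ℝ) < t := by linarith
  set y : ℝ := (t : ℝ) ^ ((2 * l + 6) / α) with hy
  set x : ℝ := (t : ℝ) ^ ((2 * l + 6) / α - (2 * l + 4)) with hx
  have hxy : (t : ℝ) ^ (2 * l + 4) * x = y := by
    rw [← Real.rpow_natCast, hx, hy, ← Real.rpow_add ht0]
    congr 1
    push_cast
    ring
  have hx6 : (t : ℝ) ^ 6 ≤ x := by
    rw [← Real.rpow_natCast, hx]
    refine Real.rpow_le_rpow_of_exponent_le ht' ?_
    rw [mul_sub, mul_one_div] at hl
    push_cast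
    linarith
  have hx1 : 1 ≤ x := (one_le_pow₀ ht').trans hx6
  have hyα : y ^ (-α) = ((t : ℝ) ^ (2 * l + 6))⁻¹ := by
    rw [hy, ← Real.rpow_mul ht0.le, ← Real.rpow_natCast, ← Real.rpow_neg ht0.le]
    congr 1
    push_cast
    field_simp
  have hy0 : 0 < y := Real.rpow_pos_of_pos ht0 _
  have hceil := Nat.le_ceil x
  have hceil' := (Nat.ceil_lt_add_one (zero_le_one.trans hx1)).le
  have htJ : (0 : ℝ) < (t : ℝ) ^ (2 * l + 6) := pow_pos ht0 _
  have htp : (0 : ℝ) < (t : ℝ) ^ (2 * l + 4) := pow_pos ht0 _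
  refine ⟨2 * ⌈x⌉₊, _, rfl, even_two_mul _, ?_, ?_⟩
  · have : ((t ^ 6 : ℕ) : ℝ) ≤ ⌈x⌉₊ := by push_cast; linarith
    have := Nat.cast_le.1 this
    omega
  set n : ℕ := 2 * (l + 4) * (t ^ (2 * l + 4) * (2 * ⌈x⌉₊)) with hn
  have hn' : (n : ℝ) = 4 * (l + 4) * ((t : ℝ) ^ (2 * l + 4) * ⌈x⌉₊) := by
    rw [hn]; push_cast; ring
  have h1 : y ≤ (t : ℝ) ^ (2 * l + 4) * ⌈x⌉₊ := hxy ▸ by gcongr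
  have h2 : (t : ℝ) ^ (2 * l + 4) * ⌈x⌉₊ ≤ 2 * y := by
    rw [← hxy]
    nlinarith
  have hny : y ≤ n := by
    rw [hn']
    nlinarith [(Nat.cast_nonneg l : (0 : ℝ) ≤ l)]
  have hnC : (n : ℝ) ≤ 8 * (l + 4) * y := by
    rw [hn']
    nlinarith [mul_le_mul_of_nonneg_left h2 (by positivity : (0 : ℝ) ≤ 4 * (l + 4))]
  have hC : (1 : ℝ) ≤ 8 * (l + 4) := by linarith [(Nat.cast_nonneg l : (0 : ℝ) ≤ l)]
  refine ⟨?_, ?_, hnC.trans ?_⟩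
  · have := Real.rpow_le_rpow_of_nonpos hy0 hny (neg_nonpos.2 hα0.le)
    rw [hyα] at this
    exact (mul_le_mul_of_nonneg_right this htJ.le).trans_eq (inv_mul_cancel₀ htJ.ne')
  · have h3 := Real.rpow_le_rpow_of_nonpos (hy0.trans_le hny) hnC (neg_nonpos.2 hα0.le)
    rw [Real.mul_rpow (zero_le_one.trans hC) hy0.le, hyα] at h3
    have h4 : (8 * (l + 4) : ℝ)⁻¹ ≤ (8 * (l + 4) : ℝ) ^ (-α) := by
      rw [← Real.rpow_neg_one]
      exact Real.rpow_le_rpow_of_exponent_le hC (by linarith)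
    rw [← div_le_iff₀' (by positivity), one_div]
    calc _ ≤ _ := h4
      _ = (8 * (l + 4) : ℝ) ^ (-α) * ((t : ℝ) ^ (2 * l + 6))⁻¹ * (t : ℝ) ^ (2 * l + 6) := by
        rw [inv_mul_cancel_right₀ htJ.ne']
      _ ≤ _ := mul_le_mul_of_nonneg_right h3 htJ.le
  · rw [hy, ← Real.rpow_natCast]
    gcongr
    exact Nat.le_ceil _

theorem frequently_half_le_prob {α : ℝ} (hα0 : 0 < α) (hα1 : α < 1) {l : ℕ} (hl3 : 3 ≤ l)
    (hl : 4 ≤ (2 * l + 6) * (1 / α - 1)) :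
    ∃ᶠ n : ℕ in atTop,
      1 / 2 ≤ prob n ((n : ℝ) ^ (-α)) fun G => ∃ S, IsEvenWitness l G S := by
  have hC : (1 : ℝ) ≤ 8 * (l + 4) := by linarith [(Nat.cast_nonneg l : (0 : ℝ) ≤ l)]
  obtain ⟨t₀, ht₀⟩ := eventually_atTop.1 (eventually_towerBounds hl3 hC ⌈(2 * l + 6) / α⌉₊
    (by positivity : (0 : ℝ) < 1 / (4 * (l + 4))))
  refine frequently_atTop.2 fun N => ?_
  let t := max 1 (max t₀ N)
  have ht1 : 1 ≤ t := le_max_left _ _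
  obtain ⟨H, n, hn, hH, htH, h1, h2, h3⟩ := exists_size hα0 hα1 hl ht1
  have hH0 : 0 < H := (pow_pos ht1 6).trans_le htH
  have hM : 0 < t ^ (2 * l + 4) * H := mul_pos (pow_pos ht1 _) hH0
  have htn : t ≤ n := by
    rw [hn]
    calc t ≤ t ^ (2 * l + 4) := Nat.le_self_pow (by omega) t
      _ ≤ t ^ (2 * l + 4) * H := Nat.le_mul_of_pos_right _ hH0
      _ ≤ _ := Nat.le_mul_of_pos_left _ (by omega)
  have hp : (n : ℝ) ^ (-α) ∈ I := ⟨by positivity, Real.rpow_le_one_of_one_le_of_nonpos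
    (by exact_mod_cast ht1.trans htn) (neg_nonpos.2 hα0.le)⟩
  refine ⟨n, (le_max_right t₀ N).trans ((le_max_right _ _).trans htn), ?_⟩
  rw [prob_eq_binomialRandom_real n ⟨_, hp⟩]
  exact half_le_real_isEvenWitness _ hM
    (ht₀ t ((le_max_left t₀ N).trans (le_max_right _ _)) _ H n hp.1 h1 h2 htH h3) hn
    (hH.mul_left _)

end Likely

/-- For every α ∈ (0,1) there exist m ∈ ℕ and a first-order sentence φ in the
language L_m such that the probability that G(n, n^{−α}) EMSO-satisfies φ does not converge
as n → ∞: the EMSO convergence law fails for G(n, n^{−α}). -/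
theorem stmt2 (α : ℝ) (hα0 : 0 < α) (hα1 : α < 1) :
    ∃ m : ℕ, ∃ φ : (Lang m).Sentence,
      ¬ ∃ l : ℝ,
          Tendsto (fun n : ℕ => prob n ((n : ℝ) ^ (-α)) (fun G => EMSOSat G φ))
            atTop (nhds l) := by
  obtain ⟨l, hl⟩ := exists_nat_ge (max 3 (4 / (1 / α - 1)))
  have hα : 0 < 1 / α - 1 := sub_pos.2 ((one_lt_div hα0).2 hα1)
  have hl3 : 3 ≤ l := by exact_mod_cast (le_max_left _ _).trans hl
  have hl4 : 4 ≤ (2 * l + 6) * (1 / α - 1) := by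
    rw [← div_le_iff₀ hα]
    linarith [(le_max_right _ _).trans hl, (Nat.cast_nonneg l : (0 : ℝ) ≤ l)]
  obtain ⟨φ, hφ⟩ := exists_sentence l
  refine ⟨_, φ, fun ⟨L, hL⟩ => ?_⟩
  simp only [hφ] at hL
  have hodd : ∃ᶠ n : ℕ in atTop,
      prob n ((n : ℝ) ^ (-α)) (fun G => ∃ S, IsEvenWitness l G S) = 0 := by
    refine frequently_atTop.2 fun N => ⟨2 * N + 1, by omega, Finset.sum_eq_zero fun G _ => ?_⟩
    refine if_neg fun ⟨S, hS⟩ => ?_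
    have := hS.even
    grind
  have h0 := isClosed_singleton.mem_of_frequently_of_tendsto hodd hL
  have h1 := isClosed_Ici.mem_of_frequently_of_tendsto
    (frequently_half_le_prob hα0 hα1 hl3 hl4) hL
  rw [Set.mem_singleton_iff.1 h0, Set.mem_Ici] at h1
  norm_num at h1
end
end

section
/- Let α ∈ (0,1/2), let γ ≥ 0 be an integer, let 0 < c < (1−α)/k_γ and ε > 0, and let (n_i) be a strictly increasing sequence of positive integers such that for every i there is no integer a ≥ 1 with a + (γ+1)(4^a−1)/3 ∈ (c·k_γ·f(n_i), k_γ·f(n_i) + ε). Then P(there exist an integer a ≥ 1 and an induced copy F of W_a^γ in G(n_i, n_i^{−α}) such that every vertex outside F has a neighbor in F) → 0 as i → ∞. -/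
open Filter FirstOrder

noncomputable section

/-! ### Probabilities of edge events -/

lemma prob_mono {n : ℕ} {p : ℝ} (hp0 : 0 ≤ p) (hp1 : p ≤ 1) {Q R : SimpleGraph (Fin n) → Prop}
    (h : ∀ G, Q G → R G) : prob n p Q ≤ prob n p R := by
  classical
  refine Finset.sum_le_sum fun G _ => ?_
  have hw : 0 ≤ p ^ edgeCt G * (1 - p) ^ (n * (n - 1) / 2 - edgeCt G) :=
    mul_nonneg (pow_nonneg hp0 _) (pow_nonneg (sub_nonneg.2 hp1) _)
  by_cases hQ : Q G
  · simp [hQ, h G hQ]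
  · by_cases hR : R G <;> simp [hQ, hR, hw]

lemma prob_nonneg {n : ℕ} {p : ℝ} (hp0 : 0 ≤ p) (hp1 : p ≤ 1) (Q : SimpleGraph (Fin n) → Prop) :
    0 ≤ prob n p Q := by
  have h := prob_mono (n := n) hp0 hp1 (Q := fun _ => False) (R := Q) (fun _ => False.elim)
  simpa [prob] using h

/-- A weighted union bound: if every graph with `Q` satisfies at least `M` of the properties `R i`,
then `M * P(Q) ≤ ∑ i, P(R i)`. -/
lemma mul_prob_le_sum_prob {n : ℕ} {p : ℝ} (hp0 : 0 ≤ p) (hp1 : p ≤ 1) {ι : Type*} (I : Finset ι)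
    (Q : SimpleGraph (Fin n) → Prop) (R : ι → SimpleGraph (Fin n) → Prop) (M : ℕ)
    (h : ∀ G, Q G → ∃ J ⊆ I, M ≤ J.card ∧ ∀ i ∈ J, R i G) :
    M * prob n p Q ≤ ∑ i ∈ I, prob n p (R i) := by
  classical
  unfold prob
  rw [Finset.sum_comm, Finset.mul_sum]
  refine Finset.sum_le_sum fun G _ => ?_
  have hw : 0 ≤ p ^ edgeCt G * (1 - p) ^ (n * (n - 1) / 2 - edgeCt G) :=
    mul_nonneg (pow_nonneg hp0 _) (pow_nonneg (sub_nonneg.2 hp1) _)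
  by_cases hQ : Q G
  · obtain ⟨J, hJI, hJ, hR⟩ := h G hQ
    rw [if_pos hQ]
    calc _ ≤ (J.card : ℝ) * (p ^ edgeCt G * (1 - p) ^ (n * (n - 1) / 2 - edgeCt G)) := by
          gcongr
      _ = ∑ i ∈ J, (p ^ edgeCt G * (1 - p) ^ (n * (n - 1) / 2 - edgeCt G)) := by simp
      _ = ∑ i ∈ J, if R i G then p ^ edgeCt G * (1 - p) ^ (n * (n - 1) / 2 - edgeCt G) else 0 :=
          Finset.sum_congr rfl fun i hi => by rw [if_pos (hR i hi)]
      _ ≤ _ := by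
          refine (Finset.sum_le_sum_of_subset_of_nonneg hJI fun i _ _ => ?_).trans
            (le_of_eq (Finset.sum_congr rfl fun i _ => ?_))
          · split_ifs <;> simp [hw]
          · congr
  · rw [if_neg hQ, mul_zero]
    exact Finset.sum_nonneg fun i _ => by split_ifs <;> simp [hw]

lemma prob_le_sum_prob {n : ℕ} {p : ℝ} (hp0 : 0 ≤ p) (hp1 : p ≤ 1) {ι : Type*} (I : Finset ι)
    (Q : SimpleGraph (Fin n) → Prop) (R : ι → SimpleGraph (Fin n) → Prop)
    (h : ∀ G, Q G → ∃ i ∈ I, R i G) : prob n p Q ≤ ∑ i ∈ I, prob n p (R i) := by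
  have := mul_prob_le_sum_prob hp0 hp1 I Q R 1 fun G hG => by
    obtain ⟨i, hi, hR⟩ := h G hG
    exact ⟨{i}, by simpa using hi, by simp, by simpa using hR⟩
  simpa using this

/-- The probability that `A` consists of edges and `B` of non-edges. -/
lemma prob_edges {n : ℕ} (p : ℝ) (A B : Finset (Sym2 (Fin n)))
    (hA : ∀ e ∈ A, ¬ e.IsDiag) (hB : ∀ e ∈ B, ¬ e.IsDiag) (hAB : Disjoint A B) :
    prob n p (fun G => (∀ e ∈ A, e ∈ G.edgeSet) ∧ ∀ e ∈ B, e ∉ G.edgeSet) =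
      p ^ A.card * (1 - p) ^ B.card := by
  classical
  set U : Finset (Sym2 (Fin n)) := Finset.univ.filter fun e => ¬ e.IsDiag with hU
  have hUc : U.card = n * (n - 1) / 2 := by
    have := Sym2.card_subtype_not_diag (α := Fin n)
    rw [Fintype.card_subtype, Fintype.card_fin, Nat.choose_two_right] at this
    exact this
  have hAU : A ⊆ U := fun e he => by simp [hU, hA e he]
  have hBU : B ⊆ U := fun e he => by simp [hU, hB e he]
  set V := U \ (A ∪ B) with hV
  have hVc : U.card = A.card + B.card + V.card := by
    rw [hV, Finset.card_sdiff_of_subset (Finset.union_subset hAU hBU),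
      Finset.card_union_of_disjoint hAB]
    have := Finset.card_le_card (Finset.union_subset hAU hBU)
    rw [Finset.card_union_of_disjoint hAB] at this
    omega
  unfold prob
  have key : ∑ F ∈ V.powerset, p ^ A.card * (1 - p) ^ B.card *
      (p ^ F.card * (1 - p) ^ (V.card - F.card)) = p ^ A.card * (1 - p) ^ B.card := by
    rw [← Finset.mul_sum, Finset.sum_pow_mul_eq_add_pow]; simp
  rw [← key]
  refine (@Finset.sum_filter _ _ _ _ _ (Classical.decPred _) _).symm.trans ?_
  refine Finset.sum_bij' (fun G _ => G.edgeFinset \ A)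
    (fun F _ => SimpleGraph.fromEdgeSet ((A ∪ F : Finset _) : Set (Sym2 (Fin n)))) ?_ ?_ ?_ ?_ ?_
  · intro G hG
    simp only [Finset.mem_filter, Finset.mem_univ, true_and] at hG
    rw [Finset.mem_powerset]
    intro e he
    simp only [Finset.mem_sdiff, SimpleGraph.mem_edgeFinset] at he
    simp only [hV, hU, Finset.mem_sdiff, Finset.mem_filter, Finset.mem_univ, true_and,
      Finset.mem_union, not_or]
    exact ⟨G.not_isDiag_of_mem_edgeSet he.1, he.2, fun h => hG.2 e h he.1⟩
  · intro F hF
    rw [Finset.mem_powerset] at hF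
    simp only [Finset.mem_filter, Finset.mem_univ, true_and, SimpleGraph.edgeSet_fromEdgeSet,
      Set.mem_sdiff, Finset.mem_coe, Finset.mem_union]
    refine ⟨fun e he => ⟨Or.inl he, hA e he⟩, fun e he h => ?_⟩
    rcases h.1 with h | h
    · exact Finset.disjoint_left.1 hAB h he
    · have := hF h
      simp [hV, he] at this
  · intro G hG
    simp only [Finset.mem_filter, Finset.mem_univ, true_and] at hG
    have : A ∪ (G.edgeFinset \ A) = G.edgeFinset := by
      apply Finset.union_sdiff_of_subset
      intro e he
      simpa using hG.1 e he
    simp [this]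
  · intro F hF
    rw [Finset.mem_powerset] at hF
    ext e
    simp only [Finset.mem_sdiff, SimpleGraph.mem_edgeFinset, SimpleGraph.edgeSet_fromEdgeSet,
      Set.mem_sdiff, Finset.mem_coe, Finset.mem_union]
    constructor
    · tauto
    · intro he
      have := hF he
      simp only [hV, hU, Finset.mem_sdiff, Finset.mem_filter, Finset.mem_univ, true_and,
        Finset.mem_union, not_or] at this
      exact ⟨⟨Or.inr he, this.1⟩, this.2.1⟩
  · intro G hG
    simp only [Finset.mem_filter, Finset.mem_univ, true_and] at hG
    have hAG : A ⊆ G.edgeFinset := fun e he => by simpa using hG.1 e he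
    have hGU : G.edgeFinset \ A ⊆ V := by
      intro e he
      simp only [Finset.mem_sdiff, SimpleGraph.mem_edgeFinset] at he
      simp only [hV, hU, Finset.mem_sdiff, Finset.mem_filter, Finset.mem_univ, true_and,
        Finset.mem_union, not_or]
      exact ⟨G.not_isDiag_of_mem_edgeSet he.1, he.2, fun h => hG.2 e h he.1⟩
    have hc1 := Finset.card_sdiff_add_card_eq_card hAG
    have hc2 := Finset.card_le_card hGU
    have hec : edgeCt G = G.edgeFinset.card := by
      rw [edgeCt, Nat.card_eq_fintype_card, SimpleGraph.edgeFinset_card]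
    rw [hec, ← hUc, hVc, ← hc1, show A.card + B.card + V.card - ((G.edgeFinset \ A).card + A.card) =
      B.card + (V.card - (G.edgeFinset \ A).card) by omega]
    ring

/-- The probability that a given injection of `W` is an embedding of `H` as an induced subgraph. -/
lemma prob_comap_eq {n : ℕ} (p : ℝ) {W : Type*} [Fintype W] (H : SimpleGraph W) (φ : W ↪ Fin n) :
    prob n p (fun G => G.comap φ = H) = p ^ (Nat.card H.edgeSet) *
      (1 - p) ^ ((Fintype.card W).choose 2 - Nat.card H.edgeSet) := by
  classical
  have hd : ∀ e : Sym2 W, (e.map φ).IsDiag ↔ e.IsDiag := by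
    intro e
    induction e with | _ x y => simp
  have hm : ∀ K : SimpleGraph W, ∀ e ∈ K.edgeFinset.image (Sym2.map φ), ¬ e.IsDiag := by
    intro K e he
    obtain ⟨f, hf, rfl⟩ := Finset.mem_image.1 he
    rw [hd]
    exact K.not_isDiag_of_mem_edgeSet (by simpa using hf)
  have hinj := Sym2.map.injective φ.injective
  have h := prob_edges p (H.edgeFinset.image (Sym2.map φ)) (Hᶜ.edgeFinset.image (Sym2.map φ))
    (hm H) (by convert hm Hᶜ) (by
      rw [Finset.disjoint_image hinj]
      simpa using (disjoint_compl_right : Disjoint H Hᶜ))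
  rw [Finset.card_image_of_injective _ hinj, Finset.card_image_of_injective _ hinj] at h
  have hc : Hᶜ.edgeFinset.card = (Fintype.card W).choose 2 - H.edgeFinset.card := by
    have := SimpleGraph.card_edgeFinset_top_eq_card_choose_two (V := W)
    rw [← this]
    have h2 : (⊤ : SimpleGraph W).edgeFinset = H.edgeFinset ∪ Hᶜ.edgeFinset := by
      ext e; induction e with | _ x y =>
      simp only [SimpleGraph.mem_edgeFinset, SimpleGraph.mem_edgeSet, SimpleGraph.top_adj,
        Finset.mem_union, SimpleGraph.compl_adj]
      have := H.ne_of_adj (a := x) (b := y)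
      tauto
    have h3 : Disjoint H.edgeFinset Hᶜ.edgeFinset := by
      simpa using (disjoint_compl_right : Disjoint H Hᶜ)
    rw [h2, Finset.card_union_of_disjoint h3]
    omega
  rw [hc] at h
  rw [Nat.card_eq_fintype_card, ← SimpleGraph.edgeFinset_card, ← h]
  congr 1
  funext G
  apply propext
  simp only [Finset.forall_mem_image, SimpleGraph.mem_edgeFinset]
  constructor
  · rintro rfl
    refine ⟨fun e => ?_, fun e => ?_⟩ <;> induction e with | _ x y => simp
  · rintro ⟨h1, h2⟩
    ext x y
    have h1' := @h1 s(x, y)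
    have h2' := @h2 s(x, y)
    simp only [SimpleGraph.mem_edgeSet, Sym2.map_mk, SimpleGraph.compl_adj] at h1' h2'
    by_cases hxy : x = y
    · subst hxy; simp
    · simp only [SimpleGraph.comap_adj]
      tauto

/-- The probability that every vertex outside `s` has a neighbor in `s`. -/
lemma prob_dominating {n : ℕ} (p : ℝ) (s : Finset (Fin n)) :
    prob n p (fun G => ∀ v ∉ s, ∃ u ∈ s, G.Adj v u) = (1 - (1 - p) ^ s.card) ^ (n - s.card) := by
  classical
  have hR : ∀ R ∈ sᶜ.powerset, prob n p (fun G => ∀ v ∈ R, ∀ u ∈ s, ¬ G.Adj v u) =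
      ((1 - p) ^ s.card) ^ R.card := by
    intro R hR
    have hRs : ∀ v ∈ R, v ∉ s := fun v hv => by simpa using Finset.mem_powerset.1 hR hv
    have h := prob_edges p ∅ ((R ×ˢ s).image fun x => s(x.1, x.2)) (by simp) (by
      simp only [Finset.mem_image, Finset.mem_product]
      rintro e ⟨x, hx, rfl⟩ hd
      rw [Sym2.mk_isDiag_iff] at hd
      exact hRs _ hx.1 (hd ▸ hx.2)) (by simp)
    rw [Finset.card_image_of_injOn, Finset.card_product] at h
    · rw [Finset.card_empty, pow_zero, one_mul, mul_comm R.card] at h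
      rw [← pow_mul, ← h]
      congr 1
      funext G
      apply propext
      simp only [Finset.forall_mem_image, Finset.mem_product, SimpleGraph.mem_edgeSet]
      constructor
      · intro h; exact ⟨by simp, fun x hx => h _ hx.1 _ hx.2⟩
      · intro h v hv u hu; exact @h.2 (v, u) ⟨hv, hu⟩
    · rintro ⟨v, u⟩ hx ⟨v', u'⟩ hx' he
      simp only [Finset.coe_product, Set.mem_prod, Finset.mem_coe] at hx hx'
      simp only [Sym2.eq_iff] at he
      rcases he with ⟨rfl, rfl⟩ | ⟨rfl, rfl⟩
      · rfl
      · exact absurd hx'.2 (hRs _ hx.1)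
  have hind : ∀ G : SimpleGraph (Fin n),
      (if ∀ v ∉ s, ∃ u ∈ s, G.Adj v u then (1 : ℝ) else 0) =
      ∑ R ∈ sᶜ.powerset, (-1) ^ R.card * if ∀ v ∈ R, ∀ u ∈ s, ¬ G.Adj v u then (1 : ℝ) else 0 := by
    intro G
    have h1 : ∀ R : Finset (Fin n), (if ∀ v ∈ R, ∀ u ∈ s, ¬ G.Adj v u then (1 : ℝ) else 0) =
        ∏ v ∈ R, if ∀ u ∈ s, ¬ G.Adj v u then (1 : ℝ) else 0 := by
      intro R
      rw [Finset.prod_ite_zero]; simp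
    simp_rw [h1, ← Finset.prod_const, ← Finset.prod_mul_distrib]
    rw [← Finset.prod_one_add]
    have h2 : ∀ v, (1 : ℝ) + (-1) * (if ∀ u ∈ s, ¬ G.Adj v u then (1 : ℝ) else 0) =
        if ∃ u ∈ s, G.Adj v u then 1 else 0 := by
      intro v
      by_cases h : ∃ u ∈ s, G.Adj v u
      · rw [if_pos h, if_neg (by push Not; exact h)]; simp
      · rw [if_neg h, if_pos (by push Not at h; exact h)]; simp
    simp_rw [h2]
    rw [Finset.prod_ite_zero]
    simp
  calc prob n p (fun G => ∀ v ∉ s, ∃ u ∈ s, G.Adj v u)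
      = ∑ R ∈ sᶜ.powerset, (-1) ^ R.card *
          prob n p (fun G => ∀ v ∈ R, ∀ u ∈ s, ¬ G.Adj v u) := by
        unfold prob
        simp_rw [Finset.mul_sum]
        rw [Finset.sum_comm]
        refine Finset.sum_congr rfl fun G _ => ?_
        have h := congrArg (· * (p ^ edgeCt G * (1 - p) ^ (n * (n - 1) / 2 - edgeCt G))) (hind G)
        simp only [Finset.sum_mul, mul_assoc, ite_mul, one_mul, zero_mul] at h
        convert h
    _ = ∑ R ∈ sᶜ.powerset, ∏ v ∈ R, (-(1 - p) ^ s.card) := by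
        refine Finset.sum_congr rfl fun R hR' => ?_
        rw [hR R hR', Finset.prod_const, ← mul_pow]
        ring
    _ = _ := by
        rw [← Finset.prod_one_add, Finset.prod_const, Finset.card_compl, Fintype.card_fin]
        ring

/-! ### The structure of `W_a^γ` -/

lemma three_mul_ωr (a : ℕ) : 3 * ωr 4 a + 1 = 4 ^ a := by
  have h : 3 ∣ 4 ^ a - 1 := by simpa using Nat.sub_dvd_pow_sub_pow 4 1 a
  have : 1 ≤ 4 ^ a := Nat.one_le_pow _ _ (by norm_num)
  unfold ωr
  omega

lemma ωr_succ (a : ℕ) : ωr 4 (a + 1) = 4 * ωr 4 a + 1 := by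
  have h1 := three_mul_ωr a
  have h2 := three_mul_ωr (a + 1)
  rw [pow_succ] at h2
  omega

lemma heapDepth_lt {a i : ℕ} (h : i < ωr 4 a) : heapDepth 4 i < a := by
  induction a generalizing i with
  | zero => simp [ωr] at h
  | succ a ih =>
    cases i with
    | zero => simp [heapDepth]
    | succ j =>
      rw [ωr_succ] at h
      have := @ih (j / 4) (by omega)
      rw [heapDepth]
      omega

lemma card_WVert (γ a : ℕ) : Fintype.card (WVert γ a) = a + ωr 4 a * (γ + 1) := by
  simp

lemma Wbase_ne {γ a : ℕ} {x y : WVert γ a} (h : Wbase γ a x y) : x ≠ y := by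
  rintro rfl
  rcases x with u | ⟨i, m⟩ <;> simp only [Wbase] at h <;> omega

lemma WG_adj_of_Wbase {γ a : ℕ} {x y : WVert γ a} (h : Wbase γ a x y) : (WG γ a).Adj x y := by
  simp [WG, SimpleGraph.fromRel_adj, h, Wbase_ne h]

lemma Wbase_asymm {γ a : ℕ} {x y : WVert γ a} (h : Wbase γ a x y) : ¬ Wbase γ a y x := by
  intro h'
  rcases x with u | ⟨i, m⟩ <;> rcases y with v | ⟨j, l⟩ <;>
    simp only [Wbase, Fin.ext_iff] at h h' <;> omega

/-- An indexing of ordered pairs in `Wbase`: path edges of `F₁`, edges of the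
connecting paths, tree edges. -/
def Wdart (γ a : ℕ) :
    Fin (a - 1) ⊕ (Fin (ωr 4 a) × Fin (γ + 1)) ⊕ Fin (ωr 4 a - 1) → WVert γ a × WVert γ a
  | .inl i => (.inl ⟨i, by omega⟩, .inl ⟨i + 1, by omega⟩)
  | .inr (.inl (i, m)) =>
      if h : (m : ℕ) < γ then (.inr (i, m), .inr (i, ⟨m + 1, by omega⟩))
      else (.inl ⟨heapDepth 4 i, heapDepth_lt i.2⟩, .inr (i, m))
  | .inr (.inr j) => (.inr (⟨j + 1, by omega⟩, 0), .inr (⟨j / 4, by omega⟩, 0))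

lemma Wbase_Wdart (γ a : ℕ) (d) : Wbase γ a (Wdart γ a d).1 (Wdart γ a d).2 := by
  rcases d with i | ⟨i, m⟩ | j
  · simp [Wdart, Wbase]
  · by_cases h : (m : ℕ) < γ
    · simp [Wdart, h, Wbase]
    · simp only [Wdart, h, Wbase, dite_false]
      simp
      omega
  · simp [Wdart, Wbase]

lemma Wdart_injective (γ a : ℕ) : Function.Injective (Wdart γ a) := by
  rintro (i | ⟨i, m⟩ | i) (j | ⟨j, l⟩ | j) h <;> simp only [Wdart] at h <;>
    (try split_ifs at h) <;>
    simp only [Prod.mk.injEq, Sum.inl.injEq, Sum.inr.injEq, Fin.ext_iff, reduceCtorEq, and_false,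
      false_and, Fin.val_zero] at h ⊢ <;> omega

lemma card_edgeSet_WG_ge (γ a : ℕ) :
    a + ωr 4 a * (γ + 2) ≤ Nat.card (WG γ a).edgeSet + 2 := by
  have hinj : Function.Injective fun d =>
      (⟨s((Wdart γ a d).1, (Wdart γ a d).2), WG_adj_of_Wbase (Wbase_Wdart γ a d)⟩ :
        (WG γ a).edgeSet) := by
    intro d d' h
    replace h := Sym2.eq_iff.1 (congrArg Subtype.val h)
    rcases h with h | h
    · exact Wdart_injective γ a (Prod.ext h.1 h.2)
    · have h1 := Wbase_Wdart γ a d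
      rw [h.1, h.2] at h1
      exact absurd h1 (Wbase_asymm (Wbase_Wdart γ a d'))
  have h := Nat.card_le_card_of_injective _ hinj
  rw [Nat.card_eq_fintype_card, Fintype.card_sum, Fintype.card_sum, Fintype.card_prod,
    Fintype.card_fin, Fintype.card_fin, Fintype.card_fin, Fintype.card_fin] at h
  change _ ≤ Nat.card (WG γ a).edgeSet at h
  have : ωr 4 a * (γ + 2) = ωr 4 a * (γ + 1) + ωr 4 a := by ring
  omega

/-- Swap the first two children of the nodes `b + t`, `t ∈ T`. -/
def leafSwap (b : ℕ) (T : Set ℕ) (j : ℕ) : ℕ :=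
  open scoped Classical in
  if b ≤ j / 4 ∧ j / 4 - b ∈ T then
    if j % 4 = 1 then j + 1 else if j % 4 = 2 then j - 1 else j
  else j

lemma leafSwap_leafSwap (b : ℕ) (T : Set ℕ) (j : ℕ) : leafSwap b T (leafSwap b T j) = j := by
  by_cases hT : b ≤ j / 4 ∧ j / 4 - b ∈ T
  · by_cases h1 : j % 4 = 1
    · have e : leafSwap b T j = j + 1 := by simp [leafSwap, hT, h1]
      have e4 : (j + 1) / 4 = j / 4 := by omega
      have e2 : (j + 1) % 4 = 2 := by omega
      rw [e]; simp [leafSwap, hT, e4, e2]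
    · by_cases h2 : j % 4 = 2
      · have e : leafSwap b T j = j - 1 := by simp [leafSwap, hT, h2]
        have e4 : (j - 1) / 4 = j / 4 := by omega
        have e2 : (j - 1) % 4 = 1 := by omega
        rw [e]; simp only [leafSwap, hT, e4, e2, and_self, if_true]; omega
      · have e : leafSwap b T j = j := by simp [leafSwap, h1, h2]
        rw [e, e]
  · have e : leafSwap b T j = j := by simp [leafSwap, hT]
    rw [e, e]

lemma leafSwap_spec (b : ℕ) (T : Set ℕ) (j : ℕ) :
    leafSwap b T j = j ∨ b ≤ j / 4 ∧
      (j % 4 = 1 ∧ leafSwap b T j = j + 1 ∨ j % 4 = 2 ∧ leafSwap b T j = j - 1) := by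
  unfold leafSwap
  split_ifs <;> tauto

lemma heapDepth_leafSwap (b : ℕ) (T : Set ℕ) (j : ℕ) :
    heapDepth 4 (leafSwap b T j) = heapDepth 4 j := by
  rcases leafSwap_spec b T j with h | ⟨-, h | h⟩
  · rw [h]
  · obtain ⟨i, rfl⟩ : ∃ i, j = i + 1 := ⟨j - 1, by omega⟩
    rw [h.2, heapDepth, heapDepth, show (i + 1) / 4 = i / 4 by omega]
  · obtain ⟨i, rfl⟩ : ∃ i, j = i + 2 := ⟨j - 2, by omega⟩
    rw [h.2, show i + 2 - 1 = i + 1 by omega, heapDepth, heapDepth,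
      show (i + 1) / 4 = i / 4 by omega]

lemma leafSwap_lt {b : ℕ} (T : Set ℕ) {j : ℕ} (hj : j < ωr 4 (b + 2)) :
    leafSwap (ωr 4 b) T j < ωr 4 (b + 2) := by
  rw [ωr_succ, ωr_succ] at *
  rcases leafSwap_spec (ωr 4 b) T j with h | ⟨-, h | h⟩ <;> omega

/-- The involution of `W_{b+2}^γ` swapping pairs of sibling leaves of `F₂`, together with the
paths attached to them. -/
def leafPerm (γ b : ℕ) (T : Set ℕ) : Equiv.Perm (WVert γ (b + 2)) :=
  Function.Involutive.toPerm
    (Sum.map id (Prod.map (fun j => ⟨leafSwap (ωr 4 b) T j, leafSwap_lt T j.2⟩) id)) (by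
      rintro (u | ⟨i, m⟩) <;> simp [leafSwap_leafSwap])

lemma leafPerm_inl {γ b : ℕ} (T : Set ℕ) (u : Fin (b + 2)) :
    leafPerm γ b T (.inl u) = .inl u := rfl

lemma leafPerm_inr {γ b : ℕ} (T : Set ℕ) (i : Fin (ωr 4 (b + 2))) (m : Fin (γ + 1)) :
    leafPerm γ b T (.inr (i, m)) = .inr (⟨leafSwap (ωr 4 b) T i, leafSwap_lt T i.2⟩, m) := rfl

lemma Wbase_leafPerm {γ b : ℕ} (T : Set ℕ) {x y : WVert γ (b + 2)} (h : Wbase γ (b + 2) x y) :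
    Wbase γ (b + 2) (leafPerm γ b T x) (leafPerm γ b T y) := by
  rcases x with u | ⟨i, m⟩ <;> rcases y with v | ⟨j, l⟩ <;>
    simp only [leafPerm_inl, leafPerm_inr, Wbase, heapDepth_leafSwap] at h ⊢
  · exact h
  · exact h
  · rcases h with ⟨rfl, h⟩ | ⟨h0, h0', hi, hj⟩
    · exact Or.inl ⟨rfl, h⟩
    · right
      refine ⟨h0, h0', ?_⟩
      have hi' := i.2
      have e : ωr 4 (b + 2) = 4 * (4 * ωr 4 b + 1) + 1 := by rw [ωr_succ, ωr_succ]
      have hj' := leafSwap_spec (ωr 4 b) T j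
      rcases leafSwap_spec (ωr 4 b) T i with h | ⟨-, h | h⟩ <;> omega

lemma WG_adj_leafPerm (γ b : ℕ) (T : Set ℕ) (x y : WVert γ (b + 2)) :
    (WG γ (b + 2)).Adj (leafPerm γ b T x) (leafPerm γ b T y) ↔ (WG γ (b + 2)).Adj x y := by
  have hiff : ∀ x y, Wbase γ (b + 2) (leafPerm γ b T x) (leafPerm γ b T y) ↔
      Wbase γ (b + 2) x y := by
    intro x y
    refine ⟨fun h => ?_, Wbase_leafPerm T⟩
    have hinv : ∀ z, leafPerm γ b T (leafPerm γ b T z) = z :=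
      Function.Involutive.toPerm_involutive _
    simpa only [hinv] using Wbase_leafPerm T h
  simp only [WG, SimpleGraph.fromRel_adj, hiff, ne_eq, EmbeddingLike.apply_eq_iff_eq]

lemma leafPerm_injOn (γ b : ℕ) :
    Set.InjOn (fun T : Finset ℕ => leafPerm γ b T) (Finset.range (4 ^ b)).powerset := by
  intro S hS T hT h
  have hw := three_mul_ωr b
  ext t
  by_cases ht : t ∈ Finset.range (4 ^ b)
  · have hlt : 4 * (ωr 4 b + t) + 1 < ωr 4 (b + 2) := by
      rw [ωr_succ, ωr_succ]
      have := Finset.mem_range.1 ht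
      omega
    have h' := Equiv.congr_fun h (.inr (⟨4 * (ωr 4 b + t) + 1, hlt⟩, 0))
    have e4 : (4 * (ωr 4 b + t) + 1) / 4 = ωr 4 b + t := by omega
    have e1 : (4 * (ωr 4 b + t) + 1) % 4 = 1 := by omega
    have hv : ∀ R : Finset ℕ, leafSwap (ωr 4 b) R (4 * (ωr 4 b + t) + 1) =
        if t ∈ R then 4 * (ωr 4 b + t) + 2 else 4 * (ωr 4 b + t) + 1 := by
      intro R
      simp [leafSwap, e4, e1]
    simp only [leafPerm_inr, Sum.inr.injEq, Prod.mk.injEq, Fin.ext_iff, hv, and_true] at h'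
    by_cases h1 : t ∈ S <;> by_cases h2 : t ∈ T <;> simp [h1, h2] at h' ⊢
  · exact iff_of_false (fun h => ht (Finset.mem_powerset.1 hS h))
      (fun h => ht (Finset.mem_powerset.1 hT h))

/-! ### Union bounds over copies -/

lemma card_eq_of_isInducedCopy {V W : Type} [Fintype V] [Fintype W] {H : SimpleGraph W}
    {G : SimpleGraph V} {s : Set V} (h : IsInducedCopy H G s) : s.ncard = Fintype.card W := by
  obtain ⟨e⟩ := h
  rw [← Nat.card_eq_fintype_card, Nat.card_congr e.toEquiv, Nat.card_coe_set_eq]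

lemma prob_exists_dominating_le {n : ℕ} {p : ℝ} (hp0 : 0 ≤ p) (hp1 : p ≤ 1) (v : ℕ) :
    prob n p (fun G => ∃ s : Set (Fin n), s.ncard = v ∧ ∀ v ∉ s, ∃ u ∈ s, G.Adj v u) ≤
      (n : ℝ) ^ v * (1 - (1 - p) ^ v) ^ (n - v) := by
  classical
  have hq : 0 ≤ 1 - (1 - p) ^ v := sub_nonneg.2 (pow_le_one₀ (by linarith) (by linarith))
  refine (prob_le_sum_prob hp0 hp1 (Finset.powersetCard v Finset.univ) _
    (fun s G => ∀ v ∉ s, ∃ u ∈ s, G.Adj v u) ?_).trans ?_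
  · rintro G ⟨s, hs, hG⟩
    refine ⟨s.toFinset, ?_, by simpa using hG⟩
    rw [Finset.mem_powersetCard_univ, ← hs, Set.ncard_eq_toFinset_card']
  · have : ∀ s ∈ Finset.powersetCard v (Finset.univ : Finset (Fin n)),
        prob n p (fun G => ∀ v ∉ s, ∃ u ∈ s, G.Adj v u) = (1 - (1 - p) ^ v) ^ (n - v) := by
      intro s hs
      rw [prob_dominating, Finset.mem_powersetCard_univ.1 hs]
    rw [Finset.sum_congr rfl this, Finset.sum_const, Finset.card_powersetCard, Finset.card_univ,
      Fintype.card_fin, nsmul_eq_mul]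
    gcongr
    exact_mod_cast Nat.choose_le_pow n v

lemma prob_exists_copy_le {n : ℕ} {p : ℝ} (hp0 : 0 ≤ p) (hp1 : p ≤ 1) (γ b : ℕ) :
    2 ^ 4 ^ b * prob n p (fun G => ∃ s, IsInducedCopy (WG γ (b + 2)) G s) ≤
      (n : ℝ) ^ Fintype.card (WVert γ (b + 2)) * (p ^ Nat.card (WG γ (b + 2)).edgeSet *
        (1 - p) ^ ((Fintype.card (WVert γ (b + 2))).choose 2 -
          Nat.card (WG γ (b + 2)).edgeSet)) := by
  classical
  have h := mul_prob_le_sum_prob hp0 hp1 (Finset.univ : Finset (WVert γ (b + 2) ↪ Fin n))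
    (fun G => ∃ s, IsInducedCopy (WG γ (b + 2)) G s)
    (fun φ G => G.comap φ = WG γ (b + 2)) (2 ^ 4 ^ b) (by
      rintro G ⟨s, ⟨e⟩⟩
      set φ : WVert γ (b + 2) ↪ Fin n := e.toEmbedding.toEmbedding.trans (.subtype _)
      have hφ : ∀ x y, G.Adj (φ x) (φ y) ↔ (WG γ (b + 2)).Adj x y := fun x y => e.map_rel_iff
      refine ⟨(Finset.range (4 ^ b)).powerset.image
        fun T : Finset ℕ => (leafPerm γ b T).toEmbedding.trans φ, Finset.subset_univ _, ?_, ?_⟩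
      · rw [Finset.card_image_of_injOn, Finset.card_powerset, Finset.card_range]
        intro S hS T hT hST
        refine leafPerm_injOn γ b hS hT (Equiv.ext fun x => φ.injective ?_)
        exact DFunLike.congr_fun hST x
      · intro ψ hψ
        obtain ⟨T, -, rfl⟩ := Finset.mem_image.1 hψ
        ext x y
        simp only [SimpleGraph.comap_adj, Function.Embedding.trans_apply, Equiv.coe_toEmbedding,
          hφ, WG_adj_leafPerm])
  simp only [prob_comap_eq, Finset.sum_const, Finset.card_univ, Fintype.card_embedding_eq,
    Fintype.card_fin, nsmul_eq_mul] at h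
  push_cast at h
  refine h.trans ?_
  have : (0 : ℝ) ≤ 1 - p := by linarith
  gcongr
  exact_mod_cast Nat.descFactorial_le_pow _ _

/-! ### Asymptotic estimates -/

lemma eventually_log_pow_le (r : ℕ) {s δ : ℝ} (hs : 0 < s) (hδ : 0 < δ) :
    ∀ᶠ n : ℕ in atTop, Real.log n ^ r ≤ δ * (n : ℝ) ^ s := by
  have h := (isLittleO_log_rpow_rpow_atTop (r : ℝ) hs).bound hδ
  filter_upwards [tendsto_natCast_atTop_atTop.eventually h] with n hn
  rw [Real.rpow_natCast, Real.norm_eq_abs, Real.norm_eq_abs,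
    abs_of_nonneg (Real.rpow_nonneg (Nat.cast_nonneg n) s)] at hn
  exact (le_abs_self _).trans hn

lemma tendsto_natCast_rpow {s : ℝ} (hs : 0 < s) :
    Tendsto (fun n : ℕ => (n : ℝ) ^ s) atTop atTop :=
  (tendsto_rpow_atTop hs).comp tendsto_natCast_atTop_atTop

lemma tendsto_natCast_rpow_neg {s : ℝ} (hs : 0 < s) :
    Tendsto (fun n : ℕ => (n : ℝ) ^ (-s)) atTop (nhds 0) :=
  (tendsto_rpow_neg_atTop hs).comp tendsto_natCast_atTop_atTop

lemma tendsto_log_natCast : Tendsto (fun n : ℕ => Real.log n) atTop atTop :=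
  Real.tendsto_log_atTop.comp tendsto_natCast_atTop_atTop

lemma eventually_dominating_bound {α κ : ℝ} (hα : 0 < α) (hκ0 : 0 < κ) (hκ : κ < 1 - α) :
    ∀ᶠ n : ℕ in atTop, ∀ v : ℕ, (v : ℝ) ≤ κ * ff α n →
      (n : ℝ) ^ v * (1 - (1 - (n : ℝ) ^ (-α)) ^ v) ^ (n - v) ≤ Real.exp (-2 * Real.log n) := by
  obtain ⟨κ', h1, h2⟩ := exists_between hκ
  have e1 : ∀ᶠ n : ℕ in atTop, κ / (1 - (n : ℝ) ^ (-α)) < κ' := by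
    have : Tendsto (fun n : ℕ => κ / (1 - (n : ℝ) ^ (-α))) atTop (nhds (κ / (1 - 0))) :=
      tendsto_const_nhds.div (tendsto_const_nhds.sub (tendsto_natCast_rpow_neg hα)) (by norm_num)
    exact this.eventually_lt_const (by simpa using h1)
  have e2 := eventually_log_pow_le 1 (s := 1 - α) (δ := 1 / (2 * κ)) (by linarith) (by positivity)
  have e3 := eventually_log_pow_le 2 (s := 1 - κ' - α) (δ := 1 / (8 * κ)) (by linarith)
    (by positivity)
  have e4 := eventually_log_pow_le 1 (s := 1 - κ') (δ := 1 / 16) (by linarith) (by positivity)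
  have e5 := (tendsto_natCast_rpow_neg hα).eventually_lt_const (show (0 : ℝ) < 1 / 2 by norm_num)
  filter_upwards [e1, e2, e3, e4, e5, eventually_ge_atTop 1] with n e1 e2 e3 e4 e5 hn v hv
  have hn0 : (0 : ℝ) < n := by exact_mod_cast hn
  have hp0 : 0 < (n : ℝ) ^ (-α) := Real.rpow_pos_of_pos hn0 _
  have hx0 : 0 < (n : ℝ) ^ α := Real.rpow_pos_of_pos hn0 _
  have hpx : (n : ℝ) ^ (-α) * (n : ℝ) ^ α = 1 := by
    rw [← Real.rpow_add hn0]; simp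
  have hxy : (n : ℝ) ^ α * (n : ℝ) ^ (1 - α) = n := by
    rw [← Real.rpow_add hn0]; simp
  have hxz : (n : ℝ) ^ α * (n : ℝ) ^ (1 - κ' - α) = (n : ℝ) ^ (1 - κ') := by
    rw [← Real.rpow_add hn0]; congr 1; ring
  have hz : (n : ℝ) ^ (1 - κ') = n * Real.exp (-(κ' * Real.log n)) := by
    rw [Real.rpow_def_of_pos hn0, show Real.log n * (1 - κ') = Real.log n + -(κ' * Real.log n) by
      ring, Real.exp_add, Real.exp_log hn0]
  have hL : 0 ≤ Real.log n := Real.log_nonneg (by exact_mod_cast hn)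
  unfold ff at hv
  set L := Real.log n
  set p := (n : ℝ) ^ (-α)
  set x := (n : ℝ) ^ α
  have hv2 : (v : ℝ) ≤ n / 2 := by
    calc (v : ℝ) ≤ κ * (x * L) := hv
      _ ≤ κ * (x * (1 / (2 * κ) * (n : ℝ) ^ (1 - α))) := by rw [pow_one] at e2; gcongr
      _ = (x * (n : ℝ) ^ (1 - α)) / 2 := by field_simp
      _ = n / 2 := by rw [hxy]
  have hvn : v ≤ n := by
    have : (v : ℝ) ≤ n := by linarith
    exact_mod_cast this
  have hvp : v * (p / (1 - p)) ≤ κ' * L := by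
    have : 0 < 1 - p := by linarith
    calc v * (p / (1 - p)) ≤ κ * (x * L) * (p / (1 - p)) := by gcongr
      _ = κ / (1 - p) * L * (p * x) := by ring
      _ ≤ κ' * L := by rw [hpx, mul_one]; gcongr
  have hq : Real.exp (-(κ' * L)) ≤ (1 - p) ^ v := by
    have h1p : 0 < 1 - p := by linarith
    rw [← Real.exp_log h1p, ← Real.exp_nat_mul, Real.exp_le_exp]
    have := Real.one_sub_inv_le_log_of_pos h1p
    have h' : 1 - (1 - p)⁻¹ = -(p / (1 - p)) := by field_simp; ring
    rw [h'] at this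
    nlinarith [mul_le_mul_of_nonneg_left this (Nat.cast_nonneg (α := ℝ) v)]
  have hq1 : (1 - p) ^ v ≤ 1 := pow_le_one₀ (by linarith) (by linarith)
  have hnv : (n : ℝ) ^ v = Real.exp (v * L) := by
    rw [Real.exp_nat_mul, Real.exp_log hn0]
  rw [hnv]
  calc Real.exp (v * L) * (1 - (1 - p) ^ v) ^ (n - v)
      ≤ Real.exp (v * L) * (Real.exp (-(1 - p) ^ v)) ^ (n - v) := by
        have : 0 ≤ 1 - (1 - p) ^ v := by linarith
        gcongr
        exact Real.one_sub_le_exp_neg _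
    _ = Real.exp (v * L + (n - v) * (-(1 - p) ^ v)) := by
        rw [← Real.exp_nat_mul, ← Real.exp_add, Nat.cast_sub hvn]
    _ ≤ Real.exp (-2 * L) := by
        rw [Real.exp_le_exp]
        have h3 : n / 2 * Real.exp (-(κ' * L)) ≤ (n - v) * (1 - p) ^ v := by
          have : (n : ℝ) / 2 ≤ n - v := by linarith
          have : (0 : ℝ) ≤ n - v := by linarith
          gcongr
        have h4 : v * L ≤ (n : ℝ) ^ (1 - κ') / 8 := by
          calc v * L ≤ κ * (x * L) * L := by gcongr
            _ = κ * x * L ^ 2 := by ring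
            _ ≤ κ * x * (1 / (8 * κ) * (n : ℝ) ^ (1 - κ' - α)) := by gcongr
            _ = (x * (n : ℝ) ^ (1 - κ' - α)) / 8 := by field_simp
            _ = _ := by rw [hxz]
        rw [pow_one] at e4
        have h5 : n / 2 * Real.exp (-(κ' * L)) = (n : ℝ) ^ (1 - κ') / 2 := by rw [hz]; ring
        have h6 : 0 ≤ (n : ℝ) ^ (1 - κ') := Real.rpow_nonneg hn0.le _
        linarith

lemma kcoef_pos {α : ℝ} (hα : α < 1 / 2) (γ : ℕ) : 0 < kcoef α γ := by
  have hγ : (0 : ℝ) ≤ γ := Nat.cast_nonneg γ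
  have : α * ((γ : ℝ) + 2) / ((γ : ℝ) + 1) < 1 := by
    rw [div_lt_one (by positivity)]
    nlinarith
  unfold kcoef
  linarith

/-- The exponent estimate behind `eventually_copy_bound`: `v` and `e` are the numbers of vertices
and edges of `W_{b+2}^γ`, with `g = γ + 1`, `w` the size of the tree, `m = 4 ^ b`,
`x = n ^ α`, `p = n ^ (-α)` and `L = log n`. -/
lemma copy_exponent_le {α g D k L p x v e b w m : ℝ} (hα0 : 0 < α) (hα1 : α < 1)
    (hD : D = 64 * (g + 1)) (hk : 0 < k) (hk2 : k / 2 = 1 - α * (g + 1) / g) (hL : 0 ≤ L)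
    (hp0 : 0 ≤ p) (hpx : p * x = 1) (hv0 : 0 ≤ v) (hb0 : 0 ≤ b) (hw0 : 0 ≤ w)
    (hg1 : 1 ≤ g) (hpαL : p ≤ α * L) (e1 : p ≤ 1 / (10 * D)) (e3 : L ≤ k / (8 * D) * x)
    (e4 : 24 * D / k ≤ x) (hkv : k * (x * L) ≤ v) (hvR : v = b + 2 + w * g)
    (hvm : v ≤ 16 * (g + 1) * m) (hbL : b + 1 ≤ L) (heR : b + 2 + w * (g + 1) - 2 ≤ e) :
    v * L - α * L * e - p * (v * (v - 1) / 2 - e) ≤ m * Real.log 2 - 2 * L := by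
  have hD0 : 0 < D := by rw [hD]; positivity
  have h4 : 24 * D ≤ k * x := by rw [div_le_iff₀ hk] at e4; linarith
  set e0 : ℝ := b + 2 + w * (g + 1) - 2 with he0
  have t1 : 0 ≤ (α * L - p) * (e - e0) := mul_nonneg (by linarith) (by linarith)
  have t2 : v - α * e0 = k / 2 * v + α * (b + 2) / g + 2 * α := by
    rw [hk2, hvR, he0]; field_simp; ring
  have t3 : k * L ≤ p * v := by
    calc k * L = p * x * (k * L) := by rw [hpx, one_mul]
      _ = p * (k * (x * L)) := by ring
      _ ≤ p * v := by gcongr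
  have t4 : 0 ≤ v * (p * v - k * L) := mul_nonneg hv0 (by linarith)
  have t5 : α * (b + 2) / g + 2 * α ≤ L + 3 := by
    have h1 : α * (b + 2) / g ≤ α * (b + 2) := div_le_self (by positivity) hg1
    nlinarith
  have t6 : L * (α * (b + 2) / g + 2 * α) ≤ v / (4 * D) := by
    have h3 : L + 3 ≤ k * x / (4 * D) := by
      have h5 : 3 ≤ k * x / (8 * D) := by rw [le_div_iff₀ (by positivity)]; linarith
      have h6 : k * x / (4 * D) = k / (8 * D) * x + k * x / (8 * D) := by field_simp; ring
      linarith
    calc L * (α * (b + 2) / g + 2 * α) ≤ L * (k * x / (4 * D)) := by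
          gcongr; linarith
      _ = (k * (x * L)) / (4 * D) := by ring
      _ ≤ v / (4 * D) := by gcongr
  have t7 : e0 ≤ 2 * v := by rw [hvR, he0]; nlinarith
  have t8 : p * (v / 2 + e0) ≤ v / (4 * D) := by
    calc p * (v / 2 + e0) ≤ p * (5 / 2 * v) := by gcongr; linarith
      _ ≤ 1 / (10 * D) * (5 / 2 * v) := by gcongr
      _ = v / (4 * D) := by field_simp; ring
  have t9 : 2 * (v / D) ≤ m * Real.log 2 := by
    have h1 : v / D ≤ m / 4 := by
      rw [div_le_iff₀ hD0, hD]; linarith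
    nlinarith [Real.log_two_gt_d9]
  have t10 : 2 * L ≤ v / D := by
    rw [le_div_iff₀ hD0]
    nlinarith [mul_le_mul_of_nonneg_right h4 hL]
  have t11 : v / (4 * D) = v / D / 4 := by ring
  have t12 : 0 ≤ v / D := by positivity
  have t13 : v * L - α * L * e0 = L * (k / 2 * v) + L * (α * (b + 2) / g + 2 * α) := by
    linear_combination L * t2
  linarith

lemma eventually_copy_bound {α : ℝ} (hα0 : 0 < α) (hα : α < 1 / 2) (γ : ℕ) :
    ∀ᶠ n : ℕ in atTop, ∀ b v e : ℕ, v = b + 2 + ωr 4 (b + 2) * (γ + 1) →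
      b + 2 + ωr 4 (b + 2) * (γ + 2) ≤ e + 2 → e ≤ v.choose 2 → v ≤ n →
      kcoef α γ * ff α n ≤ v →
      (n : ℝ) ^ v * (((n : ℝ) ^ (-α)) ^ e * (1 - (n : ℝ) ^ (-α)) ^ (v.choose 2 - e)) ≤
        2 ^ 4 ^ b * Real.exp (-2 * Real.log n) := by
  have hk := kcoef_pos hα γ
  set g : ℝ := (γ : ℝ) + 1 with hg
  have hg1 : 1 ≤ g := by have : (0 : ℝ) ≤ γ := Nat.cast_nonneg γ; linarith
  set D : ℝ := 64 * (g + 1) with hD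
  have hD0 : 0 < D := by positivity
  have hk2 : kcoef α γ / 2 = 1 - α * (g + 1) / g := by
    rw [kcoef, hg]; ring
  set k := kcoef α γ
  have e1 := (tendsto_natCast_rpow_neg hα0).eventually_le_const
    (show 0 < 1 / (10 * D) by positivity)
  have e2 := tendsto_log_natCast.eventually_ge_atTop (1 / α)
  have e3 := eventually_log_pow_le 1 (s := α) (δ := k / (8 * D)) hα0 (by positivity)
  have e4 := (tendsto_natCast_rpow hα0).eventually_ge_atTop (24 * D / k)
  filter_upwards [e1, e2, e3, e4, eventually_ge_atTop 1] with
    n e1 e2 e3 e4 hn b v e hv he heC hvn hkv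
  have hn0 : (0 : ℝ) < n := by exact_mod_cast hn
  have hp0 : 0 < (n : ℝ) ^ (-α) := Real.rpow_pos_of_pos hn0 _
  have hx0 : 0 < (n : ℝ) ^ α := Real.rpow_pos_of_pos hn0 _
  have hpx : (n : ℝ) ^ (-α) * (n : ℝ) ^ α = 1 := by
    rw [← Real.rpow_add hn0]; simp
  have hpL : (n : ℝ) ^ (-α) = Real.exp (-(α * Real.log n)) := by
    rw [Real.rpow_def_of_pos hn0]; congr 1; ring
  have hnL : (n : ℝ) = Real.exp (Real.log n) := (Real.exp_log hn0).symm
  have hL : 0 ≤ Real.log n := Real.log_nonneg (by exact_mod_cast hn)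
  unfold ff at hkv
  set L := Real.log n
  set p := (n : ℝ) ^ (-α)
  set x := (n : ℝ) ^ α
  rw [pow_one] at e3
  have hp1 : p ≤ 1 := e1.trans (by rw [div_le_one (by positivity)]; linarith)
  have hpαL : p ≤ α * L := by
    have := mul_le_mul_of_nonneg_left e2 hα0.le
    rw [mul_one_div_cancel hα0.ne'] at this
    linarith
  have hW := three_mul_ωr (b + 2)
  set w := ωr 4 (b + 2)
  have hW' : 3 * (w : ℝ) + 1 = 16 * 4 ^ b := by
    have : ((3 * w + 1 : ℕ) : ℝ) = ((4 ^ (b + 2) : ℕ) : ℝ) := by rw [hW]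
    push_cast at this
    rw [this]; ring
  set m : ℝ := (4 : ℝ) ^ b
  have hm1 : 1 ≤ m := one_le_pow₀ (by norm_num)
  have hvR : (v : ℝ) = (b + 2) + w * g := by rw [hv, hg]; push_cast; ring
  have heR : (b : ℝ) + 2 + w * (g + 1) - 2 ≤ e := by
    have : ((b + 2 + w * (γ + 2) : ℕ) : ℝ) ≤ ((e + 2 : ℕ) : ℝ) := by exact_mod_cast he
    push_cast at this
    rw [hg]; linarith
  have hvnR : (v : ℝ) ≤ n := by exact_mod_cast hvn
  have hw0 : (0 : ℝ) ≤ w := Nat.cast_nonneg w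
  have hb0 : (0 : ℝ) ≤ b := Nat.cast_nonneg b
  have hv0 : (0 : ℝ) ≤ v := Nat.cast_nonneg v
  have hbL : (b : ℝ) + 1 ≤ L := by
    rw [← Real.exp_le_exp, ← hnL]
    calc Real.exp ((b : ℝ) + 1) = Real.exp 1 ^ (b + 1) := by
          rw [← Real.exp_nat_mul]; push_cast; ring_nf
      _ ≤ 4 ^ (b + 1) := by
          gcongr
          linarith [Real.exp_one_lt_d9]
      _ = 4 * m := by rw [pow_succ]; ring
      _ ≤ w := by linarith
      _ ≤ v := by nlinarith
      _ ≤ n := hvnR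
  have hvm : (v : ℝ) ≤ 16 * (g + 1) * m := by
    have hb : (b : ℝ) + 2 ≤ 16 * m := by
      have : ((b + 2 : ℕ) : ℝ) < ((4 ^ (b + 2) : ℕ) : ℝ) := by
        exact_mod_cast Nat.lt_pow_self (by norm_num)
      push_cast at this
      have h' : (4 : ℝ) ^ (b + 2) = 16 * m := by rw [pow_add]; ring
      linarith
    nlinarith
  have hexp : v * L - α * L * e - p * (v * (v - 1) / 2 - e) ≤ m * Real.log 2 - 2 * L := by
    exact copy_exponent_le hα0 (by linarith) hD hk hk2 hL hp0.le hpx hv0 hb0 hw0 hg1 hpαL e1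
      e3 e4 hkv hvR hvm hbL heR
  have hC : ((v.choose 2 - e : ℕ) : ℝ) = v * (v - 1) / 2 - e := by
    rw [Nat.cast_sub heC, Nat.cast_choose_two]
  calc (n : ℝ) ^ v * (p ^ e * (1 - p) ^ (v.choose 2 - e))
      ≤ Real.exp L ^ v * (Real.exp (-(α * L)) ^ e * Real.exp (-p) ^ (v.choose 2 - e)) := by
        rw [← hnL, ← hpL]
        have : 0 ≤ 1 - p := by linarith
        gcongr
        exact Real.one_sub_le_exp_neg _
    _ = Real.exp (v * L - α * L * e - p * (v * (v - 1) / 2 - e)) := by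
        rw [← Real.exp_nat_mul, ← Real.exp_nat_mul, ← Real.exp_nat_mul, ← Real.exp_add,
          ← Real.exp_add, hC]
        congr 1; ring
    _ ≤ Real.exp (m * Real.log 2 - 2 * L) := Real.exp_le_exp.2 hexp
    _ = 2 ^ 4 ^ b * Real.exp (-2 * L) := by
        rw [sub_eq_add_neg, Real.exp_add, ← neg_mul]
        congr 1
        have := Real.exp_nat_mul (Real.log 2) (4 ^ b)
        rw [Real.exp_log two_pos] at this
        rw [← this]; push_cast; rfl

/-- Lemma 1.1: Let α ∈ (0,1/2), γ ≥ 0, 0 < c < (1−α)/k_γ, ε > 0, and let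
(n_i) be a strictly increasing sequence of positive integers such that for every i there
is no integer a ≥ 1 with a + (γ+1)(4^a−1)/3 ∈ (c·k_γ·f(n_i), k_γ·f(n_i) + ε). Then the
probability that G(n_i, n_i^{−α}) contains, for some a ≥ 1, an induced copy F of W_a^γ
such that every vertex outside F has a neighbor in F, tends to 0. -/
theorem stmt3 (α : ℝ) (hα0 : 0 < α) (hα : α < 1 / 2) (γ : ℕ)
    (c ε : ℝ) (hc0 : 0 < c) (hc : c < (1 - α) / kcoef α γ) (hε : 0 < ε)
    (n : ℕ → ℕ) (hmono : StrictMono n) (hpos : ∀ i, 0 < n i)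
    (hgap : ∀ i, ¬ ∃ a : ℕ, 1 ≤ a ∧
        c * kcoef α γ * ff α (n i) < (a : ℝ) + ((γ : ℝ) + 1) * ((4 : ℝ) ^ a - 1) / 3 ∧
        (a : ℝ) + ((γ : ℝ) + 1) * ((4 : ℝ) ^ a - 1) / 3 < kcoef α γ * ff α (n i) + ε) :
    Tendsto (fun i : ℕ =>
        prob (n i) ((n i : ℝ) ^ (-α)) (fun G =>
          ∃ a : ℕ, 1 ≤ a ∧ ∃ s : Set (Fin (n i)),
            IsInducedCopy (WG γ a) G s ∧ ∀ v ∉ s, ∃ u ∈ s, G.Adj v u))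
      atTop (nhds 0) := by
  have hk := kcoef_pos hα γ
  have hκ : c * kcoef α γ < 1 - α := (lt_div_iff₀ hk).1 hc
  have hff : Tendsto (fun m : ℕ => kcoef α γ * ff α m) atTop atTop :=
    ((tendsto_natCast_rpow hα0).atTop_mul_atTop₀ tendsto_log_natCast).const_mul_atTop hk
  have hlim : Tendsto (fun i => ((n i : ℕ) : ℝ)⁻¹) atTop (nhds 0) :=
    tendsto_inv_atTop_zero.comp (tendsto_natCast_atTop_atTop.comp hmono.tendsto_atTop)
  have hp : ∀ i, 0 ≤ (n i : ℝ) ^ (-α) ∧ (n i : ℝ) ^ (-α) ≤ 1 := fun i =>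
    ⟨Real.rpow_nonneg (Nat.cast_nonneg _) _,
      Real.rpow_le_one_of_one_le_of_nonpos (by exact_mod_cast hpos i) (by linarith)⟩
  refine squeeze_zero' (Eventually.of_forall fun i => prob_nonneg (hp i).1 (hp i).2 _) ?_ hlim
  filter_upwards [hmono.tendsto_atTop.eventually
      (eventually_dominating_bound hα0 (mul_pos hc0 hk) hκ),
    hmono.tendsto_atTop.eventually (eventually_copy_bound hα0 hα γ),
    hmono.tendsto_atTop.eventually (hff.eventually_gt_atTop ((γ : ℝ) + 2))] with i h1 h2 h3
  obtain ⟨hp0, hp1⟩ := hp i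
  replace hgap := hgap i
  have hN := hpos i
  generalize n i = N at *
  have hN0 : (0 : ℝ) < N := by exact_mod_cast hN
  have hcard : ∀ a, ((Fintype.card (WVert γ a) : ℕ) : ℝ) =
      (a : ℝ) + ((γ : ℝ) + 1) * ((4 : ℝ) ^ a - 1) / 3 := by
    intro a
    have h : ((3 * ωr 4 a + 1 : ℕ) : ℝ) = ((4 ^ a : ℕ) : ℝ) := by rw [three_mul_ωr]
    push_cast at h
    rw [card_WVert, ← h]
    push_cast
    ring
  have hle : ∀ {a : ℕ} {G : SimpleGraph (Fin N)} {s : Set (Fin N)},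
      IsInducedCopy (WG γ a) G s → Fintype.card (WVert γ a) ≤ N := by
    intro a G s h
    rw [← card_eq_of_isInducedCopy h, ← Nat.card_coe_set_eq]
    simpa using Finite.card_subtype_le (· ∈ s)
  refine (prob_le_sum_prob hp0 hp1 (Finset.Icc 1 N) _ (fun a G => ∃ s : Set (Fin N),
      IsInducedCopy (WG γ a) G s ∧ ∀ v ∉ s, ∃ u ∈ s, G.Adj v u) ?_).trans ?_
  · rintro G ⟨a, ha, s, hs, hd⟩
    have := hle hs
    rw [card_WVert] at this
    exact ⟨a, Finset.mem_Icc.2 ⟨ha, by omega⟩, s, hs, hd⟩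
  have hterm : ∀ a ∈ Finset.Icc 1 N, prob N ((N : ℝ) ^ (-α)) (fun G => ∃ s : Set (Fin N),
      IsInducedCopy (WG γ a) G s ∧ ∀ v ∉ s, ∃ u ∈ s, G.Adj v u) ≤
      Real.exp (-2 * Real.log N) := by
    intro a ha
    have ha1 := (Finset.mem_Icc.1 ha).1
    by_cases hsmall : ((Fintype.card (WVert γ a) : ℕ) : ℝ) ≤ c * kcoef α γ * ff α N
    · refine (prob_mono hp0 hp1 ?_).trans
        ((prob_exists_dominating_le hp0 hp1 (Fintype.card (WVert γ a))).trans (h1 _ hsmall))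
      rintro G ⟨s, hs, hd⟩
      exact ⟨s, card_eq_of_isInducedCopy hs, hd⟩
    by_cases hvN : Fintype.card (WVert γ a) ≤ N
    · have hlarge : kcoef α γ * ff α N ≤ (Fintype.card (WVert γ a) : ℕ) := by
        by_contra! hlt
        refine hgap ⟨a, ha1, ?_, ?_⟩ <;> rw [← hcard] <;> linarith
      obtain ⟨b, rfl⟩ : ∃ b, a = b + 2 := by
        refine ⟨a - 2, ?_⟩
        by_contra hne
        obtain rfl : a = 1 := by omega
        rw [hcard] at hlarge
        norm_num at hlarge
        linarith
      have hpos2 : (0 : ℝ) < 2 ^ 4 ^ b := by positivity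
      refine le_of_mul_le_mul_left ?_ hpos2
      refine le_trans (mul_le_mul_of_nonneg_left (prob_mono hp0 hp1 ?_) hpos2.le)
        ((prob_exists_copy_le hp0 hp1 γ b).trans
          (h2 b _ _ (card_WVert γ (b + 2)) (card_edgeSet_WG_ge γ (b + 2)) ?_ hvN hlarge))
      · rintro G ⟨s, hs, -⟩
        exact ⟨s, hs⟩
      · classical
        rw [Nat.card_eq_fintype_card, ← SimpleGraph.edgeFinset_card]
        exact SimpleGraph.card_edgeFinset_le_card_choose_two
    · refine (prob_mono hp0 hp1 (R := fun _ => False) ?_).trans ?_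
      · rintro G ⟨s, hs, -⟩
        exact hvN (hle hs)
      · simpa [prob] using (Real.exp_pos _).le
  refine (Finset.sum_le_sum hterm).trans (le_of_eq ?_)
  rw [Finset.sum_const, Nat.card_Icc, Nat.add_sub_cancel, nsmul_eq_mul,
    show -2 * Real.log N = -Real.log N + -Real.log N by ring, Real.exp_add, Real.exp_neg,
    Real.exp_log hN0]
  field_simp
end
end
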